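/- arXiv:1103.5640 — 6 statements merged into one kernel-verified Lean document; each statement's English description precedes it below -/
import Mathlib

section
/- Let W : ℝ → ℝ be a function satisfying W(x) * exp(W(x)) = x and W(x) > 0 for all x > 0. Then for all v ∈ (0, π) and all x > 0, the real number x + v * csc(v) * exp(-v * cot v) is strictly positive, and W(x)/x = (1/π) * ∫ from 0 to π of (v^2 + (1 - v*cot v)^2) / (x + v*csc(v)*exp(-v*cot v)) dv. -/
open Real

namespace LambertStieltjes

open Set Filter Topology

/-- In the strip `|Im w| < π` the equation `w * exp w = a * exp a`, `a > 0`, has only the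
solution `w = a`. -/
lemma eq_of_mul_exp_eq {a : ℝ} (ha : 0 < a) {w : ℂ} (hw : |w.im| < π)
    (h : w * Complex.exp w = a * Complex.exp a) : w = a := by
  have hx : 0 < a * Real.exp a := by positivity
  obtain ⟨u, v⟩ := w
  simp only at hw
  have hre := congrArg Complex.re h
  have him := congrArg Complex.im h
  simp only [Complex.mul_re, Complex.mul_im, Complex.exp_re, Complex.exp_im, Complex.ofReal_re,
    Complex.ofReal_im, Real.cos_zero, Real.sin_zero, mul_zero, zero_mul, mul_one, sub_zero,
    add_zero] at hre him
  have he := Real.exp_pos u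
  have him' : u * Real.sin v + v * Real.cos v = 0 := by
    have : Real.exp u * (u * Real.sin v + v * Real.cos v) = 0 := by linarith
    simpa [he.ne'] using this
  have key : a * Real.exp a * Real.sin v = -(v * Real.exp u) := by
    rw [← hre]
    linear_combination Real.exp u * Real.cos v * him' -
      v * Real.exp u * (Real.sin_sq_add_cos_sq v)
  have hv : v = 0 := by
    rcases lt_trichotomy v 0 with hv | hv | hv
    · have := Real.sin_neg_of_neg_of_neg_pi_lt hv (abs_lt.1 hw).1
      nlinarith [mul_neg_of_pos_of_neg hx this, mul_neg_of_neg_of_pos hv he]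
    · exact hv
    · have := Real.sin_pos_of_pos_of_lt_pi hv (abs_lt.1 hw).2
      nlinarith [mul_pos hx this, mul_pos hv he]
  subst hv
  simp only [Real.cos_zero, Real.sin_zero, mul_zero, mul_one, sub_zero] at hre
  have hu : 0 < u := by
    by_contra! hu
    nlinarith
  have : u = a := by
    rcases lt_trichotomy u a with hl | hl | hl
    · exact absurd hre (mul_lt_mul'' hl (Real.exp_lt_exp.2 hl) hu.le he.le).ne
    · exact hl
    · exact absurd hre (mul_lt_mul'' hl (Real.exp_lt_exp.2 hl) ha.le (Real.exp_pos a).le).ne'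
  subst this
  rfl

/-- The function `(1 + w) / (a * exp a - w * exp w)` has a simple pole at `a`; after removing its
principal part it has a primitive in the strip `|Im w| < π`. -/
lemma exists_primitive {a : ℝ} (ha : 0 < a) :
    ∃ g G : ℂ → ℂ, (∀ w : ℂ, |w.im| < π → HasDerivAt G (g w) w) ∧
      (∀ w : ℂ, |w.im| < π → ContinuousAt g w) ∧
      ∀ w : ℂ, w ≠ a → g w = (1 + w) / (a * Complex.exp a - w * Complex.exp w) +
        Complex.exp (-a) / (w - a) := by
  set S : Set ℂ := {w | |w.im| < π}
  have hSo : IsOpen S := isOpen_lt (by fun_prop) continuous_const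
  have hSc : Convex ℝ S := by
    have : S = Complex.imLm ⁻¹' Ioo (-π) π := by
      ext w; simp [S, abs_lt]
    rw [this]
    exact (convex_Ioo _ _).linear_preimage _
  have haS : (a : ℂ) ∈ S := by simp [S, Real.pi_pos]
  set p : ℂ → ℂ := fun w ↦ w * Complex.exp w
  have hpd : Differentiable ℂ p := by fun_prop
  have hpa : HasDerivAt p ((1 + a) * Complex.exp a) a :=
    ((hasDerivAt_id (a : ℂ)).mul (Complex.hasDerivAt_exp a)).congr_deriv (by simp only [id]; ring)
  set q : ℂ → ℂ := dslope p a
  have hqd : DifferentiableOn ℂ q S :=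
    (Complex.differentiableOn_dslope (hSo.mem_nhds haS)).2 hpd.differentiableOn
  have h1a : (1 + a : ℂ) ≠ 0 := by exact_mod_cast (by positivity : (1 + a : ℝ) ≠ 0)
  have hqa : q a = (1 + a) * Complex.exp a := by simp only [q, dslope_same, hpa.deriv]
  have hq : ∀ w : ℂ, w ≠ a → q w = (w * Complex.exp w - a * Complex.exp a) / (w - a) := fun w hw ↦ by
    simp only [q, dslope_of_ne _ hw, slope_def_field, p]
  have hq0 : ∀ w ∈ S, q w ≠ 0 := by
    intro w hw
    by_cases h : w = a
    · rw [h, hqa]; exact mul_ne_zero h1a (Complex.exp_ne_zero _)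
    · rw [hq w h]
      exact div_ne_zero (fun h' ↦ h (eq_of_mul_exp_eq ha hw (sub_eq_zero.1 h'))) (sub_ne_zero.2 h)
  set h : ℂ → ℂ := fun w ↦ -(1 + w) / q w
  have hh : DifferentiableOn ℂ h S := DifferentiableOn.div (by fun_prop) hqd hq0
  have hg : DifferentiableOn ℂ (dslope h a) S :=
    (Complex.differentiableOn_dslope (hSo.mem_nhds haS)).2 hh
  obtain ⟨G, hG⟩ := hSc.exists_forall_hasDerivWithinAt hg
  refine ⟨dslope h a, G, fun w hw ↦ (hG w hw).hasDerivAt (hSo.mem_nhds hw),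
    fun w hw ↦ (hg.differentiableAt (hSo.mem_nhds hw)).continuousAt, fun w hw ↦ ?_⟩
  have hwa : w - a ≠ 0 := sub_ne_zero.2 hw
  simp only [dslope_of_ne _ hw, slope_def_field, h, hqa, hq w hw]
  rw [Complex.exp_neg, ← neg_sub (w * _), div_neg, sub_div, div_div_eq_mul_div, neg_div (_ * _),
    div_div, neg_mul, neg_div, neg_div, mul_div_mul_right _ _ hwa, div_mul_cancel_left₀ h1a,
    sub_neg_eq_add]

/-- The curve along which `w * exp w` is a negative real, for `0 < v < π`. -/
noncomputable def cutCurve (v : ℝ) : ℂ := ⟨-v * Real.cot v, v⟩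

lemma cutCurve_mul_exp {v : ℝ} (hv : v ∈ Ioo 0 π) :
    cutCurve v * Complex.exp (cutCurve v) =
      -((v * (1 / Real.sin v) * Real.exp (-v * Real.cot v) : ℝ) : ℂ) := by
  have hs := (Real.sin_pos_of_mem_Ioo hv).ne'
  rw [← Complex.ofReal_neg]
  apply Complex.ext
  · simp only [cutCurve, Complex.mul_re, Complex.exp_re, Complex.exp_im, Complex.ofReal_re]
    generalize Real.exp _ = e
    rw [Real.cot_eq_cos_div_sin]
    field_simp
    linear_combination (-v * e) * Real.sin_sq_add_cos_sq v
  · simp only [cutCurve, Complex.mul_im, Complex.exp_re, Complex.exp_im, Complex.ofReal_im]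
    generalize Real.exp _ = e
    rw [Real.cot_eq_cos_div_sin]
    field_simp
    ring

lemma hasDerivAt_cutCurve {v : ℝ} (hv : v ∈ Ioo 0 π) :
    HasDerivAt cutCurve ⟨-Real.cot v + v / Real.sin v ^ 2, 1⟩ v := by
  have hs := (Real.sin_pos_of_mem_Ioo hv).ne'
  have hc : HasDerivAt (fun v ↦ -v * Real.cot v) (-Real.cot v + v / Real.sin v ^ 2) v := by
    have h := (hasDerivAt_id v).neg.mul ((Real.hasDerivAt_cos v).div (Real.hasDerivAt_sin v) hs)
    refine (h.congr_of_eventuallyEq (.of_forall fun y ↦ ?_)).congr_deriv ?_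
    · simp [Real.cot_eq_cos_div_sin]
    · rw [Real.cot_eq_cos_div_sin]
      simp only [Pi.neg_apply, id, Pi.div_apply]
      field_simp
      linear_combination v * Real.sin_sq_add_cos_sq v
  have h := hc.ofReal_comp.add ((hasDerivAt_id v).ofReal_comp.mul_const Complex.I)
  refine (h.congr_of_eventuallyEq (.of_forall fun y ↦ ?_)).congr_deriv ?_
  · simp only [cutCurve, Complex.mk_eq_add_mul_I, Pi.add_apply, id]
  · simp [Complex.mk_eq_add_mul_I]

lemma stieltjes_denom_pos {v : ℝ} (hv : v ∈ Ioo 0 π) {x : ℝ} (hx : 0 < x) :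
    0 < x + v * (1 / Real.sin v) * Real.exp (-v * Real.cot v) := by
  have := Real.sin_pos_of_mem_Ioo hv
  have := hv.1
  positivity

lemma im_integrand {v : ℝ} (hv : v ∈ Ioo 0 π) (x : ℝ) :
    ((1 + cutCurve v) / (x - cutCurve v * Complex.exp (cutCurve v)) *
      ⟨-Real.cot v + v / Real.sin v ^ 2, 1⟩).im =
      (v ^ 2 + (1 - v * Real.cot v) ^ 2) /
          (x + v * (1 / Real.sin v) * Real.exp (-v * Real.cot v)) := by
  have hs := (Real.sin_pos_of_mem_Ioo hv).ne'
  rw [cutCurve_mul_exp hv, sub_neg_eq_add, ← Complex.ofReal_add, div_mul_eq_mul_div,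
    Complex.div_ofReal_im]
  congr 1
  simp only [cutCurve, Complex.mul_im, Complex.add_re, Complex.add_im, Complex.one_re,
    Complex.one_im, Real.cot_eq_cos_div_sin]
  field_simp
  linear_combination -v ^ 2 * Real.sin_sq_add_cos_sq v

lemma tendsto_cutCurve_zero : Tendsto cutCurve (𝓝[>] 0) (𝓝 (-1)) := by
  have h : Tendsto (fun v ↦ -(Real.cos v / Real.sinc v)) (𝓝[>] 0) (𝓝 (-1)) := by
    have : ContinuousAt (fun v ↦ -(Real.cos v / Real.sinc v)) 0 :=
      (Real.continuous_cos.continuousAt.div Real.continuous_sinc.continuousAt (by simp)).neg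
    simpa [ContinuousAt] using this.tendsto.mono_left nhdsWithin_le_nhds
  have h' : Tendsto (fun v : ℝ ↦ -v * Real.cot v) (𝓝[>] 0) (𝓝 (-1)) := by
    refine h.congr' ?_
    filter_upwards [self_mem_nhdsWithin] with v hv
    rw [Real.sinc_of_ne_zero (ne_of_gt hv), Real.cot_eq_cos_div_sin]
    field_simp
  have hv : Tendsto (fun v : ℝ ↦ (v : ℂ)) (𝓝[>] 0) (𝓝 0) := by
    have := Complex.continuous_ofReal.tendsto (0 : ℝ)
    simpa using this.mono_left nhdsWithin_le_nhds
  have := ((Complex.continuous_ofReal.tendsto _).comp h').add (hv.mul_const Complex.I)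
  simp only [Complex.ofReal_neg, Complex.ofReal_one, zero_mul, add_zero] at this
  exact this.congr fun v ↦ (Complex.mk_eq_add_mul_I _ _).symm

lemma tendsto_cutCurve_re_pi : Tendsto (fun v ↦ (cutCurve v).re) (𝓝[<] π) atTop := by
  have hsin : Tendsto Real.sin (𝓝[<] π) (𝓝[>] 0) := by
    refine tendsto_nhdsWithin_iff.2 ⟨?_, ?_⟩
    · simpa using (Real.continuous_sin.tendsto π).mono_left nhdsWithin_le_nhds
    · filter_upwards [Ioo_mem_nhdsLT Real.pi_pos] with v hv
      exact Real.sin_pos_of_mem_Ioo hv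
  have hn : Tendsto (fun v ↦ -v * Real.cos v) (𝓝[<] π) (𝓝 π) := by
    have : Continuous fun v ↦ -v * Real.cos v := by fun_prop
    simpa using (this.tendsto π).mono_left nhdsWithin_le_nhds
  refine (hn.pos_mul_atTop Real.pi_pos hsin.inv_tendsto_nhdsGT_zero).congr fun v ↦ ?_
  simp [cutCurve, Real.cot_eq_cos_div_sin, div_eq_mul_inv, mul_assoc]

lemma norm_integrand_le {a : ℝ} (ha : 0 < a) {w : ℂ} (hre : a < w.re) (him : |w.im| < π) :
    ‖(1 + w) / (a * Complex.exp a - w * Complex.exp w) + Complex.exp (-a) / (w - a)‖ ≤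
      (1 + (1 + π) * w.re⁻¹) * (Real.exp w.re - a * Real.exp a * w.re⁻¹)⁻¹ +
        Real.exp (-a) * (w.re - a)⁻¹ := by
  have hR : 0 < w.re := ha.trans hre
  have hlt : a * Real.exp a < w.re * Real.exp w.re :=
    mul_lt_mul'' hre (Real.exp_lt_exp.2 hre) ha.le (Real.exp_pos a).le
  have hden : w.re * Real.exp w.re - a * Real.exp a ≤
      ‖(a * Complex.exp a - w * Complex.exp w : ℂ)‖ := by
    rw [norm_sub_rev]
    refine le_trans ?_ (norm_sub_norm_le _ _)
    rw [norm_mul, norm_mul, Complex.norm_exp, Complex.norm_exp, Complex.norm_real,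
      Complex.ofReal_re, Real.norm_of_nonneg ha.le]
    gcongr
    exact Complex.re_le_norm w
  have hnum : ‖1 + w‖ ≤ w.re + (1 + π) := by
    have h1 : ‖1 + w‖ ≤ ‖(1 : ℂ)‖ + ‖w‖ := norm_add_le _ _
    have h2 := Complex.norm_le_abs_re_add_abs_im w
    rw [abs_of_pos hR] at h2
    rw [norm_one] at h1
    linarith
  refine (norm_add_le _ _).trans (add_le_add ?_ ?_)
  · have : (1 + (1 + π) * w.re⁻¹) * (Real.exp w.re - a * Real.exp a * w.re⁻¹)⁻¹ =
        (w.re + (1 + π)) / (w.re * Real.exp w.re - a * Real.exp a) := by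
      have h1 : w.re * Real.exp w.re - a * Real.exp a ≠ 0 := (sub_pos.2 hlt).ne'
      have h2 : Real.exp w.re - a * Real.exp a * w.re⁻¹ =
          (w.re * Real.exp w.re - a * Real.exp a) * w.re⁻¹ := by field_simp
      rw [h2, mul_inv, inv_inv]
      field_simp
    rw [this, norm_div]
    have := sub_pos.2 hlt
    gcongr
  · rw [norm_div, ← div_eq_mul_inv]
    have h1 : w.re - a ≤ ‖w - a‖ := by simpa using Complex.re_le_norm (w - a)
    have h2 : ‖Complex.exp (-a)‖ = Real.exp (-a) := by simp [Complex.norm_exp]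
    have := sub_pos.2 hre
    rw [h2]
    gcongr

lemma tendsto_norm_bound (a : ℝ) :
    Tendsto (fun R : ℝ ↦ (1 + (1 + π) * R⁻¹) * (Real.exp R - a * Real.exp a * R⁻¹)⁻¹ +
        Real.exp (-a) * (R - a)⁻¹) atTop (𝓝 0) := by
  have h1 : Tendsto (fun R : ℝ ↦ 1 + (1 + π) * R⁻¹) atTop (𝓝 (1 + (1 + π) * 0)) :=
    (tendsto_inv_atTop_zero.const_mul _).const_add _
  have h2 : Tendsto (fun R : ℝ ↦ Real.exp R - a * Real.exp a * R⁻¹) atTop atTop := by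
    simp only [sub_eq_add_neg]
    exact Real.tendsto_exp_atTop.atTop_add (tendsto_inv_atTop_zero.const_mul _).neg
  have h3 : Tendsto (fun R : ℝ ↦ (R - a)⁻¹) atTop (𝓝 0) :=
    tendsto_inv_atTop_zero.comp (tendsto_atTop_add_const_right _ (-a) tendsto_id)
  simpa using (h1.mul (tendsto_inv_atTop_zero.comp h2)).add (h3.const_mul (Real.exp (-a)))

/-- A primitive as in `exists_primitive` has constant imaginary part on the real line. -/
lemma im_primitive_ofReal {a : ℝ} {g G : ℂ → ℂ}
    (hG : ∀ w : ℂ, |w.im| < π → HasDerivAt G (g w) w)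
    (hgc : ∀ w : ℂ, |w.im| < π → ContinuousAt g w)
    (hg : ∀ w : ℂ, w ≠ a → g w = (1 + w) / (a * Complex.exp a - w * Complex.exp w) +
        Complex.exp (-a) / (w - a)) (s t : ℝ) : (G s).im = (G t).im := by
  have him (u : ℝ) : |(u : ℂ).im| < π := by simp [Real.pi_pos]
  have hcont : Continuous fun u : ℝ ↦ (g u).im := by
    refine continuous_iff_continuousAt.2 fun u ↦ ?_
    exact Complex.continuous_im.continuousAt.comp
      ((hgc u (him u)).comp Complex.continuous_ofReal.continuousAt)
  have hzero : (fun u : ℝ ↦ (g u).im) = fun _ ↦ 0 := by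
    refine hcont.ext_on (dense_compl_singleton a) continuous_const fun u hu ↦ ?_
    have hu' : (u : ℂ) ≠ a := fun h ↦ hu (Complex.ofReal_injective h)
    have : g u = (((1 + u) / (a * Real.exp a - u * Real.exp u) +
        Real.exp (-a) / (u - a) : ℝ) : ℂ) := by
      rw [hg u hu']; push_cast; rfl
    simp only [this, Complex.ofReal_im]
  have hd (u : ℝ) : HasDerivAt (fun u : ℝ ↦ (G u).im) 0 u := by
    have h := Complex.imCLM.hasFDerivAt.comp_hasDerivAt u (hG u (him u)).comp_ofReal
    rw [← congrFun hzero u]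
    exact h
  exact is_const_of_deriv_eq_zero (fun u ↦ (hd u).differentiableAt) (fun u ↦ (hd u).deriv) s t

lemma tendsto_im_primitive_pi {a : ℝ} (ha : 0 < a) {g G : ℂ → ℂ}
    (hG : ∀ w : ℂ, |w.im| < π → HasDerivAt G (g w) w)
    (hgc : ∀ w : ℂ, |w.im| < π → ContinuousAt g w)
    (hg : ∀ w : ℂ, w ≠ a → g w = (1 + w) / (a * Complex.exp a - w * Complex.exp w) +
        Complex.exp (-a) / (w - a)) :
    Tendsto (fun v ↦ (G (cutCurve v)).im) (𝓝[<] π) (𝓝 (G (-1)).im) := by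
  have hB := ((tendsto_norm_bound a).comp tendsto_cutCurve_re_pi).mul_const π
  rw [zero_mul] at hB
  rw [tendsto_iff_norm_sub_tendsto_zero]
  refine squeeze_zero' (.of_forall fun _ ↦ norm_nonneg _) ?_ hB
  filter_upwards [Ioo_mem_nhdsLT Real.pi_pos,
    tendsto_cutCurve_re_pi.eventually (eventually_gt_atTop a)] with v hv hva
  set R := (cutCurve v).re
  set B := (1 + (1 + π) * R⁻¹) * (Real.exp R - a * Real.exp a * R⁻¹)⁻¹ +
        Real.exp (-a) * (R - a)⁻¹
  have hw : cutCurve v = R + v * Complex.I := by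
    rw [← Complex.re_add_im (cutCurve v)]; rfl
  have hder (s : ℝ) (hs : s ∈ Icc 0 v) : HasDerivWithinAt (fun s : ℝ ↦ G (R + s * Complex.I))
      (g (R + s * Complex.I) * Complex.I) (Icc 0 v) s := by
    have him : |((R : ℂ) + s * Complex.I).im| < π := by
      simpa [abs_of_nonneg hs.1] using hs.2.trans_lt hv.2
    have h2 : HasDerivAt (fun s : ℝ ↦ (R : ℂ) + s * Complex.I) Complex.I s := by
      simpa using ((hasDerivAt_id s).ofReal_comp.mul_const Complex.I).const_add (R : ℂ)
    exact (HasDerivAt.comp s (hG _ him) h2).hasDerivWithinAt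
  have hbd (s : ℝ) (hs : s ∈ Ico 0 v) : ‖g (R + s * Complex.I) * Complex.I‖ ≤ B := by
    have him : |((R : ℂ) + s * Complex.I).im| < π := by
      simpa [abs_of_nonneg hs.1] using hs.2.trans hv.2
    have hre : ((R : ℂ) + s * Complex.I).re = R := by simp
    have hne : (R : ℂ) + s * Complex.I ≠ a := fun h ↦ by
      have := congrArg Complex.re h
      rw [hre, Complex.ofReal_re] at this
      exact hva.ne' this
    have := norm_integrand_le ha (w := R + s * Complex.I) (by rwa [hre]) him
    rw [norm_mul, Complex.norm_I, mul_one, hg _ hne]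
    rwa [hre] at this
  have key := norm_image_sub_le_of_norm_deriv_le_segment' hder hbd v (right_mem_Icc.2 hv.1.le)
  have hB0 : 0 ≤ B := (norm_nonneg _).trans (hbd 0 (left_mem_Ico.2 hv.1))
  have hconst : (G (-1)).im = (G R).im := by
    simpa using im_primitive_ofReal hG hgc hg (-1) R
  rw [hconst, ← Complex.sub_im, hw]
  refine (Complex.abs_im_le_norm _).trans (le_trans ?_
    (mul_le_mul_of_nonneg_left hv.2.le hB0))
  simpa using key

lemma tendsto_arg_cutCurve_zero {a : ℝ} (ha : 0 < a) :
    Tendsto (fun v ↦ Complex.arg (cutCurve v - a)) (𝓝[>] 0) (𝓝 π) := by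
  refine (Complex.tendsto_arg_nhdsWithin_im_nonneg_of_re_neg_of_im_zero
    (z := -1 - a) (by simp; linarith) (by simp)).comp (tendsto_nhdsWithin_iff.2 ⟨?_, ?_⟩)
  · exact tendsto_cutCurve_zero.sub_const _
  · filter_upwards [self_mem_nhdsWithin] with v hv
    simpa [cutCurve] using le_of_lt hv

lemma tendsto_arg_cutCurve_pi (a : ℝ) :
    Tendsto (fun v ↦ Complex.arg (cutCurve v - a)) (𝓝[<] π) (𝓝 0) := by
  have hre : Tendsto (fun v ↦ (cutCurve v - a).re) (𝓝[<] π) atTop := by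
    simpa [sub_eq_add_neg] using tendsto_atTop_add_const_right _ (-a) tendsto_cutCurve_re_pi
  have hn : Tendsto (fun v ↦ ‖cutCurve v - a‖) (𝓝[<] π) atTop :=
    tendsto_atTop_mono (fun v ↦ Complex.re_le_norm _) hre
  have him : Tendsto (fun v ↦ (cutCurve v - a).im) (𝓝[<] π) (𝓝 π) := by
    simp only [cutCurve, Complex.sub_im, Complex.ofReal_im, sub_zero]
    exact tendsto_id.mono_left nhdsWithin_le_nhds
  have h := (Real.continuous_arcsin.tendsto _).comp (him.div_atTop hn)
  rw [Real.arcsin_zero] at h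
  refine h.congr' ?_
  filter_upwards [hre.eventually (eventually_ge_atTop 0)] with v hv
  exact (Complex.arg_of_re_nonneg hv).symm

/-- A nonnegative derivative on `(a, b)` of a function with one-sided limits at the endpoints
integrates to the difference of the limits. -/
lemma integral_eq_sub_of_nonneg_of_tendsto {f f' : ℝ → ℝ} {a b fa fb : ℝ} (hab : a < b)
    (hderiv : ∀ v ∈ Ioo a b, HasDerivAt f (f' v) v) (hpos : ∀ v ∈ Ioo a b, 0 ≤ f' v)
    (ha : Tendsto f (𝓝[>] a) (𝓝 fa)) (hb : Tendsto f (𝓝[<] b) (𝓝 fb)) :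
    ∫ v in a..b, f' v = fb - fa := by
  have hcont : ContinuousOn f (Ioo a b) := fun v hv ↦ (hderiv v hv).continuousAt.continuousWithinAt
  have hint : IntervalIntegrable f' MeasureTheory.volume a b := by
    rw [intervalIntegrable_iff_integrableOn_Ioc_of_le hab.le]
    refine intervalIntegral.integrableOn_deriv_of_nonneg
      (continuousOn_Icc_extendFrom_Ioo hcont ha hb) (fun v hv ↦ ?_) hpos
    refine (hderiv v hv).congr_of_eventuallyEq ?_
    filter_upwards [Ioo_mem_nhds hv.1 hv.2] with y hy
    exact extendFrom_eq (subset_closure hy) (hcont y hy)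
  exact intervalIntegral.integral_eq_sub_of_hasDerivAt_of_tendsto hab hderiv hint ha hb

lemma integral_stieltjes {a : ℝ} (ha : 0 < a) :
    ∫ v in (0:ℝ)..π, (v ^ 2 + (1 - v * Real.cot v) ^ 2) /
          (a * Real.exp a + v * (1 / Real.sin v) * Real.exp (-v * Real.cot v)) =
      π * Real.exp (-a) := by
  obtain ⟨g, G, hG, hgc, hg⟩ := exists_primitive ha
  have hx : 0 < a * Real.exp a := by positivity
  have h0 : Tendsto (fun v ↦ (G (cutCurve v)).im - Real.exp (-a) * Complex.arg (cutCurve v - a))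
      (𝓝[>] 0) (𝓝 ((G (-1)).im - Real.exp (-a) * π)) := by
    have hc : ContinuousAt G (-1) := (hG (-1) (by simp [Real.pi_pos])).continuousAt
    exact ((Complex.continuous_im.tendsto _).comp (hc.tendsto.comp tendsto_cutCurve_zero)).sub
      ((tendsto_arg_cutCurve_zero ha).const_mul _)
  have h1 := (tendsto_im_primitive_pi ha hG hgc hg).sub
    ((tendsto_arg_cutCurve_pi a).const_mul (Real.exp (-a)))
  rw [integral_eq_sub_of_nonneg_of_tendsto Real.pi_pos (fun v hv ↦ ?_) (fun v hv ↦ ?_) h0 h1]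
  · ring
  · have hd := hasDerivAt_cutCurve hv
    have him : |(cutCurve v).im| < π := by
      simpa [cutCurve, abs_of_pos hv.1] using hv.2
    have hslit : cutCurve v - a ∈ Complex.slitPlane :=
      Or.inr (by simpa [cutCurve] using hv.1.ne')
    have hne : cutCurve v ≠ a := fun h ↦ by
      simpa [cutCurve, hv.1.ne'] using congrArg Complex.im h
    have h := (HasDerivAt.comp v (hG _ him) hd).sub
      (((hd.sub_const (a : ℂ)).clog_real hslit).const_mul (Complex.exp (-a)))
    have h' := Complex.imCLM.hasFDerivAt.comp_hasDerivAt v h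
    refine (h'.congr_of_eventuallyEq (.of_forall fun y ↦ ?_)).congr_deriv ?_
    · have : Complex.exp (-a) = (Real.exp (-a) : ℂ) := by push_cast; rfl
      simp only [Function.comp_apply, Pi.sub_apply, Complex.imCLM_apply, this, Complex.sub_im,
        Complex.im_ofReal_mul, Complex.log_im]
    · rw [← im_integrand hv, Complex.imCLM_apply, hg _ hne]
      push_cast
      ring_nf
  · have := stieltjes_denom_pos hv hx
    positivity

end LambertStieltjes

/-- Stieltjes integral representation of `W(x)/x` for the principal real branch of
Lambert W on `(0, ∞)`. -/
theorem lambertW_div_self_stieltjes (W : ℝ → ℝ)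
    (hW : ∀ x > 0, W x * Real.exp (W x) = x) (hWpos : ∀ x > 0, W x > 0) :
    (∀ v ∈ Set.Ioo 0 π, ∀ x > (0:ℝ),
        0 < x + v * (1 / Real.sin v) * Real.exp (-v * Real.cot v)) ∧
    ∀ x > (0:ℝ),
      W x / x = (1 / π) * ∫ v in (0:ℝ)..π,
        (v ^ 2 + (1 - v * Real.cot v) ^ 2) /
          (x + v * (1 / Real.sin v) * Real.exp (-v * Real.cot v)) := by
  refine ⟨fun v hv x hx ↦ LambertStieltjes.stieltjes_denom_pos hv hx, fun x hx ↦ ?_⟩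
  have ha := hWpos x hx
  have h := LambertStieltjes.integral_stieltjes ha
  rw [hW x hx] at h
  rw [h, one_div, inv_mul_cancel_left₀ Real.pi_ne_zero, Real.exp_neg, div_eq_iff hx.ne']
  nth_rewrite 3 [← hW x hx]
  field_simp
end

section
/- Let W : ℝ → ℝ satisfy W(x) * exp(W(x)) = x and W(x) > 0 for all x > 0. Then for all x > 0, the derivative of W at x equals (1/π) * ∫ from 0 to π of 1 / (x + v*csc(v)*exp(-v*cot v)) dv. -/
open Real

open Set Filter Topology

theorem mul_exp_injOn_pos {a b : ℝ} (ha : 0 < a) (hb : 0 < b)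
    (h : a * Real.exp a = b * Real.exp b) : a = b := by
  rcases lt_trichotomy a b with hab | hab | hab
  · exact absurd h (mul_lt_mul hab (Real.exp_le_exp.2 hab.le) (Real.exp_pos _) hb.le).ne
  · exact hab
  · exact absurd h (mul_lt_mul hab (Real.exp_le_exp.2 hab.le) (Real.exp_pos _) ha.le).ne'

theorem hasStrictDerivAt_mul_exp (w : ℝ) :
    HasStrictDerivAt (fun y : ℝ => y * Real.exp y) ((1 + w) * Real.exp w) w := by
  have h := (hasStrictDerivAt_id w).mul (Real.hasStrictDerivAt_exp w)
  exact h.congr_deriv (by simp; ring)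

/-- The derivative of any positive right inverse of `y ↦ y * exp y` on `(0, ∞)`. -/
theorem hasDerivAt_of_mul_exp_eq {W : ℝ → ℝ}
    (hW : ∀ x > 0, W x * Real.exp (W x) = x) (hWpos : ∀ x > 0, W x > 0) {x : ℝ} (hx : 0 < x) :
    HasDerivAt W ((1 + W x) * Real.exp (W x))⁻¹ x := by
  have hw := hWpos x hx
  have hne : (1 + W x) * Real.exp (W x) ≠ 0 := by positivity
  have hs := hasStrictDerivAt_mul_exp (W x)
  have hinv := (hs.to_localInverse hne).hasDerivAt
  have hright := hs.eventually_right_inverse hne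
  have hself : hs.localInverse _ _ _ hne (W x * Real.exp (W x)) = W x :=
    HasStrictFDerivAt.localInverse_apply_image (hs.hasStrictFDerivAt_equiv hne)
  have hpos := hinv.continuousAt.eventually (lt_mem_nhds (hself.symm ▸ hw))
  simp only [hW x hx] at hinv hright hpos
  refine hinv.congr_of_eventuallyEq ?_
  filter_upwards [hright, hpos, lt_mem_nhds hx] with y hy hy0 hy1
  exact mul_exp_injOn_pos (hWpos y hy1) hy0 ((hW y hy1).trans hy.symm)

/-- In the strip `|im z| < π`, the equation `z * exp z = w * exp w` has only the solution `w`. -/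
theorem eq_of_mul_cexp_eq {w : ℝ} (hw : 0 < w) {z : ℂ} (hz : z.im ∈ Ioo (-π) π)
    (h : z * Complex.exp z = (w * Real.exp w : ℝ)) : z = w := by
  have hre := congrArg Complex.re h
  have him := congrArg Complex.im h
  simp only [Complex.mul_re, Complex.mul_im, Complex.exp_re, Complex.exp_im, Complex.ofReal_re,
    Complex.ofReal_im] at hre him
  have hpos : 0 < w * Real.exp w := by positivity
  have hmul : (w * Real.exp w) * Real.sin z.im = - (Real.exp z.re * z.im) := by
    linear_combination -Real.sin z.im * hre + Real.cos z.im * him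
      - Real.exp z.re * z.im * Real.sin_sq_add_cos_sq z.im
  have hb : z.im = 0 := by
    rcases lt_trichotomy z.im 0 with h0 | h0 | h0
    · have := Real.sin_neg_of_neg_of_neg_pi_lt h0 hz.1
      nlinarith [mul_pos hpos (neg_pos.2 this), mul_pos (Real.exp_pos z.re) (neg_pos.2 h0)]
    · exact h0
    · have := Real.sin_pos_of_pos_of_lt_pi h0 hz.2
      nlinarith [mul_pos hpos this, mul_pos (Real.exp_pos z.re) h0]
  simp only [hb, Real.cos_zero, Real.sin_zero, mul_one, mul_zero, sub_zero] at hre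
  have ha : 0 < z.re := pos_of_mul_pos_left (hre ▸ hpos) (Real.exp_pos _).le
  exact Complex.ext (mul_exp_injOn_pos ha hw hre) (by simp [hb])

/-- Subtracting the principal part of `1 / (w * exp w - z * exp z)` at `w` leaves a function
with a primitive on the strip `|im z| < π`. -/
theorem exists_primitive_sub_principalPart {w : ℝ} (hw : 0 < w) :
    ∃ F f : ℂ → ℂ, (∀ z : ℂ, z.im ∈ Ioo (-π) π → HasDerivAt F (f z) z) ∧
      ContinuousOn f (Complex.im ⁻¹' Ioo (-π) π) ∧
      ∀ z : ℂ, z.im ∈ Ioo (-π) π → z ≠ w →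
        f z = 1 / ((w * Real.exp w : ℝ) - z * Complex.exp z)
          + (((1 + w) * Real.exp w)⁻¹ : ℝ) / (z - w) := by
  set S : Set ℂ := Complex.im ⁻¹' Ioo (-π) π
  have hSo : IsOpen S := isOpen_Ioo.preimage Complex.continuous_im
  have hSc : Convex ℝ S := (convex_Ioo (-π) π).linear_preimage Complex.imLm
  have hwS : S ∈ 𝓝 (w : ℂ) := hSo.mem_nhds (by simp [S, Real.pi_pos])
  set p : ℂ → ℂ := fun z => z * Complex.exp z
  have hp : ∀ z, HasDerivAt p ((1 + z) * Complex.exp z) z := fun z =>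
    ((hasDerivAt_id z).mul (Complex.hasDerivAt_exp z)).congr_deriv (by simp; ring)
  set q : ℂ → ℂ := dslope p w
  have hqw : q w = ((1 + w) * Real.exp w : ℝ) := by
    simp [q, dslope_same, (hp w).deriv]
  have hpw : p w = (w * Real.exp w : ℝ) := by simp [p]
  have hqz : ∀ z : ℂ, (z - w) * q z = p z - p w := fun z => by
    simpa using sub_smul_dslope p w z
  have hqd : DifferentiableOn ℂ q S :=
    (Complex.differentiableOn_dslope hwS).2 fun z _ => (hp z).differentiableAt.differentiableWithinAt
  have hq0 : ∀ z ∈ S, q z ≠ 0 := by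
    intro z hz h0
    by_cases hzw : z = w
    · rw [hzw, hqw] at h0
      have : (1 + w) * Real.exp w ≠ 0 := by positivity
      exact this (by exact_mod_cast h0)
    · have := hqz z
      rw [h0, mul_zero, hpw, eq_comm, sub_eq_zero] at this
      exact hzw (eq_of_mul_cexp_eq hw hz this)
  have hid : DifferentiableOn ℂ (fun z => -dslope (fun z => (q z)⁻¹) w z) S :=
    ((Complex.differentiableOn_dslope hwS).2 (hqd.inv hq0)).neg
  obtain ⟨F, hF⟩ := hSc.exists_forall_hasDerivWithinAt hid
  refine ⟨F, _, fun z hz => (hF z hz).hasDerivAt (hSo.mem_nhds hz), hid.continuousOn, ?_⟩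
  intro z hz hzw
  have h1 : (z - w) * dslope (fun z => (q z)⁻¹) w z = (q z)⁻¹ - (q w)⁻¹ := by
    simpa using sub_smul_dslope (fun z => (q z)⁻¹) (w : ℂ) z
  have h2 : (w * Real.exp w : ℝ) - z * Complex.exp z = -((z - w) * q z) := by
    rw [hqz, hpw]; ring
  have hq := hq0 z hz
  rw [h2, Complex.ofReal_inv, ← hqw]
  have h3 : dslope (fun z => (q z)⁻¹) w z = ((q z)⁻¹ - (q w)⁻¹) / (z - w) := by
    rw [← h1]; field_simp
  rw [h3]
  have hqw0 := hq0 w (mem_of_mem_nhds hwS)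
  field_simp
  ring

/-- The Hankel-type curve `-v cot v + i v`, on which `z * exp z` is real and negative. -/
noncomputable def hankelCurve (v : ℝ) : ℂ := ⟨-v * Real.cot v, v⟩

theorem hankelCurve_eq (v : ℝ) :
    hankelCurve v = (-v * Real.cot v : ℝ) + v * Complex.I :=
  Complex.mk_eq_add_mul_I _ _

theorem hankelCurve_mul_cexp {v : ℝ} (hv : Real.sin v ≠ 0) :
    hankelCurve v * Complex.exp (hankelCurve v)
      = -(v * (1 / Real.sin v) * Real.exp (-v * Real.cot v) : ℝ) := by
  apply Complex.ext
  · simp only [hankelCurve, Complex.mul_re, Complex.exp_re, Complex.exp_im, Complex.neg_re,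
      Complex.ofReal_re, Real.cot_eq_cos_div_sin]
    field_simp
    linear_combination -v * Real.sin_sq_add_cos_sq v
  · simp only [hankelCurve, Complex.mul_im, Complex.exp_re, Complex.exp_im, Complex.neg_im,
      Complex.ofReal_im, Real.cot_eq_cos_div_sin]
    field_simp
    ring

theorem exists_hasDerivAt_hankelCurve {v : ℝ} (hv : Real.sin v ≠ 0) :
    ∃ d : ℂ, d.im = 1 ∧ HasDerivAt hankelCurve d v := by
  have hr : DifferentiableAt ℝ (fun v : ℝ => -v * Real.cot v) v := by
    simp only [Real.cot_eq_cos_div_sin]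
    fun_prop (disch := assumption)
  have h := hr.hasDerivAt.ofReal_comp.add ((hasDerivAt_id v).ofReal_comp.mul_const Complex.I)
  refine ⟨_, ?_, h.congr_of_eventuallyEq (Eventually.of_forall hankelCurve_eq)⟩
  simp

theorem tendsto_hankelCurve_zero : Tendsto hankelCurve (𝓝[>] 0) (𝓝 (-1)) := by
  have hre : Tendsto (fun v : ℝ => -v * Real.cot v) (𝓝[>] 0) (𝓝 (-1)) := by
    have h : Tendsto (fun v : ℝ => -(Real.cos v / Real.sinc v)) (𝓝 0) (𝓝 (-1)) := by
      have := ((Real.continuous_cos.tendsto 0).div (Real.continuous_sinc.tendsto 0)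
        (by simp)).neg
      simpa using this
    refine (h.mono_left nhdsWithin_le_nhds).congr' ?_
    filter_upwards [self_mem_nhdsWithin] with v (hv : 0 < v)
    rw [Real.sinc_of_ne_zero hv.ne', Real.cot_eq_cos_div_sin, div_div_eq_mul_div]
    ring
  have him : Tendsto (fun v : ℝ => v) (𝓝[>] 0) (𝓝 0) := nhdsWithin_le_nhds
  have h := ((Complex.continuous_ofReal.tendsto _).comp hre).add
    (((Complex.continuous_ofReal.tendsto _).comp him).mul_const Complex.I)
  simp only [Complex.ofReal_neg, Complex.ofReal_one, Complex.ofReal_zero, zero_mul, add_zero] at h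
  exact h.congr fun v => (hankelCurve_eq v).symm

theorem tendsto_re_hankelCurve_pi :
    Tendsto (fun v => (hankelCurve v).re) (𝓝[<] π) atTop := by
  have hs : Tendsto (fun v => (Real.sin v)⁻¹) (𝓝[<] π) atTop := by
    refine tendsto_inv_nhdsGT_zero.comp (tendsto_nhdsWithin_iff.2 ⟨?_, ?_⟩)
    · have := Real.continuous_sin.tendsto π
      rw [Real.sin_pi] at this
      exact this.mono_left nhdsWithin_le_nhds
    · filter_upwards [Ioo_mem_nhdsLT Real.pi_pos] with v hv
      exact Real.sin_pos_of_mem_Ioo hv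
  have hc : Tendsto (fun v => -v * Real.cos v) (𝓝[<] π) (𝓝 π) := by
    have : Continuous fun v => -v * Real.cos v := by fun_prop
    have := this.tendsto π
    simp only [Real.cos_pi, mul_neg, mul_one, neg_neg] at this
    exact this.mono_left nhdsWithin_le_nhds
  refine (hc.pos_mul_atTop Real.pi_pos hs).congr fun v => ?_
  simp only [hankelCurve, Real.cot_eq_cos_div_sin]
  ring

theorem tendsto_arg_sub_hankelCurve_pi (w : ℝ) :
    Tendsto (fun v => (w - hankelCurve v).arg) (𝓝[<] π) (𝓝 (-π)) := by
  have hre := tendsto_re_hankelCurve_pi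
  have hlim : Tendsto (fun v => v / ‖w - hankelCurve v‖) (𝓝[<] π) (𝓝 0) := by
    refine Tendsto.div_atTop (a := π) nhdsWithin_le_nhds ?_
    refine tendsto_atTop_mono (fun v => ?_) (tendsto_atTop_add_const_right _ (-w) hre)
    have := Complex.abs_re_le_norm (w - hankelCurve v)
    have h2 := neg_abs_le (w - hankelCurve v).re
    simp only [Complex.sub_re, Complex.ofReal_re] at this h2
    linarith
  have h := ((Real.continuous_arcsin.tendsto 0).comp hlim).sub_const π
  simp only [Real.arcsin_zero, zero_sub] at h
  refine h.congr' ?_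
  filter_upwards [hre.eventually_gt_atTop w, Ioo_mem_nhdsLT Real.pi_pos] with v hv hv0
  rw [Complex.arg_of_re_neg_of_im_neg (by simpa using hv)
    (by simpa [hankelCurve] using hv0.1)]
  simp [hankelCurve]

theorem intervalIntegral_stieltjes {w : ℝ} (hw : 0 < w) :
    ∫ v in (0:ℝ)..π,
      1 / (w * Real.exp w + v * (1 / Real.sin v) * Real.exp (-v * Real.cot v))
        = π * ((1 + w) * Real.exp w)⁻¹ := by
  obtain ⟨F, f, hF, hfc, hf⟩ := exists_primitive_sub_principalPart hw
  set c : ℝ := ((1 + w) * Real.exp w)⁻¹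
  set x : ℝ := w * Real.exp w
  have hx : 0 < x := by positivity
  have hc : 0 < c := by positivity
  have hreal : ∀ u : ℝ, (u : ℂ).im ∈ Ioo (-π) π := fun u => by simp [Real.pi_pos]
  have hFim : ∀ u : ℝ, (F u).im = (F (-1)).im := by
    have hzero : ∀ u : ℝ, (f u).im = 0 := by
      have hcont : Continuous fun u : ℝ => (f u).im :=
        Complex.continuous_im.comp (hfc.comp_continuous Complex.continuous_ofReal hreal)
      refine congrFun (hcont.ext_on (dense_compl_singleton w) continuous_const fun u hu => ?_)
      have : (1 / ((x : ℂ) - u * Complex.exp u) + (c : ℂ) / (u - w))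
          = ((1 / (x - u * Real.exp u) + c / (u - w) : ℝ) : ℂ) := by push_cast; rfl
      change (f u).im = 0
      rw [hf u (hreal u) (by simpa using hu), this, Complex.ofReal_im]
    have hderiv : ∀ u : ℝ, HasDerivAt (fun u : ℝ => (F u).im) 0 u := fun u => by
      have h := Complex.imCLM.hasFDerivAt.comp_hasDerivAt u (hF u (hreal u)).comp_ofReal
      exact h.congr_deriv (by simp [hzero])
    intro u
    have := is_const_of_deriv_eq_zero (fun u => (hderiv u).differentiableAt)
      (fun u => (hderiv u).deriv) u (-1)
    simpa using this
  have hbound : ∀ z : ℂ, z.im ∈ Ioo (-π) π → w < z.re →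
      ‖F z - F z.re‖ ≤ ((z.re * Real.exp z.re - x)⁻¹ + c * (z.re - w)⁻¹) * π := by
    intro z hz hwz
    have hz0 : 0 < z.re := hw.trans hwz
    have hxz : 0 < z.re * Real.exp z.re - x :=
      sub_pos.2 (mul_lt_mul hwz (Real.exp_le_exp.2 hwz.le) (Real.exp_pos _) hz0.le)
    have hconv : Convex ℝ {y : ℂ | y.re = z.re ∧ y.im ∈ Ioo (-π) π} :=
      ((convex_singleton z.re).linear_preimage Complex.reLm).inter
        ((convex_Ioo (-π) π).linear_preimage Complex.imLm)
    have h := hconv.norm_image_sub_le_of_norm_hasDerivWithin_le (f := F) (f' := f)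
      (C := (z.re * Real.exp z.re - x)⁻¹ + c * (z.re - w)⁻¹)
      (fun y hy => (hF y hy.2).hasDerivWithinAt) (fun y hy => ?_)
      (x := z.re) (y := z) ⟨by simp, hreal _⟩ ⟨rfl, hz⟩
    · refine h.trans (mul_le_mul_of_nonneg_left ?_ (by
        have := sub_pos.2 hwz; positivity))
      have : z - z.re = z.im * Complex.I := by
        rw [sub_eq_iff_eq_add, add_comm]; exact (Complex.re_add_im z).symm
      rw [this, norm_mul, Complex.norm_I, mul_one, Complex.norm_real, Real.norm_eq_abs]
      exact (abs_lt.2 hz).le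
    · have hyw : y ≠ w := fun h => by
        have := hy.1; rw [h, Complex.ofReal_re] at this; exact hwz.ne this
      rw [hf y hy.2 hyw]
      refine (norm_add_le _ _).trans (add_le_add ?_ ?_)
      · rw [one_div, norm_inv]
        refine inv_anti₀ hxz ?_
        have h1 := norm_sub_norm_le (y * Complex.exp y) x
        rw [norm_mul, Complex.norm_exp, hy.1, Complex.norm_real, Real.norm_of_nonneg hx.le,
          norm_sub_rev] at h1
        have h2 := mul_le_mul_of_nonneg_right ((le_abs_self _).trans (Complex.abs_re_le_norm y))
          (Real.exp_pos z.re).le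
        rw [hy.1] at h2
        linarith
      · rw [norm_div, Complex.norm_real, Real.norm_of_nonneg hc.le, div_eq_mul_inv]
        refine mul_le_mul_of_nonneg_left (inv_anti₀ (sub_pos.2 hwz) ?_) hc.le
        have := (le_abs_self _).trans (Complex.abs_re_le_norm (y - w))
        simpa [hy.1] using this
  set Φ : ℝ → ℝ := fun v => (F (hankelCurve v)).im - c * (w - hankelCurve v).arg
  have hΦderiv : ∀ v ∈ Ioo 0 π, HasDerivAt Φ
      (1 / (x + v * (1 / Real.sin v) * Real.exp (-v * Real.cot v))) v := by
    intro v hv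
    have hsin : Real.sin v ≠ 0 := (Real.sin_pos_of_mem_Ioo hv).ne'
    obtain ⟨d, hd, hγ⟩ := exists_hasDerivAt_hankelCurve hsin
    have hS : (hankelCurve v).im ∈ Ioo (-π) π := ⟨by simp [hankelCurve]; linarith [hv.1, hv.2], hv.2⟩
    have hne : hankelCurve v ≠ w := fun h => by
      have := congrArg Complex.im h
      simp [hankelCurve] at this
      exact hv.1.ne' this
    have hslit : (w : ℂ) - hankelCurve v ∈ Complex.slitPlane :=
      Or.inr (by simpa [hankelCurve] using hv.1.ne')
    have h1 := (hF _ hS).comp v hγ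
    have h2 := ((hγ.const_sub (w : ℂ)).clog_real hslit).const_mul (c : ℂ)
    have h3 := Complex.imCLM.hasFDerivAt.comp_hasDerivAt v (h1.sub h2)
    refine (h3.congr_deriv ?_).congr_of_eventuallyEq (Eventually.of_forall fun y => ?_)
    · have key : f (hankelCurve v) * d - c * (-d / (w - hankelCurve v))
          = ((1 / (x + v * (1 / Real.sin v) * Real.exp (-v * Real.cot v)) : ℝ) : ℂ) * d := by
        rw [hf _ hS hne, hankelCurve_mul_cexp hsin, sub_neg_eq_add, add_mul,
          ← neg_sub (hankelCurve v) (w : ℂ), neg_div_neg_eq]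
        push_cast
        ring
      rw [key, Complex.imCLM_apply, Complex.im_ofReal_mul, hd, mul_one]
    · simp [Φ, Complex.log_im]
  have hint : IntervalIntegrable
      (fun v => 1 / (x + v * (1 / Real.sin v) * Real.exp (-v * Real.cot v)))
      MeasureTheory.volume 0 π := by
    refine (intervalIntegrable_const (c := 1 / x)).mono_fun ?_ ?_
    · have : Measurable
          (fun v => 1 / (x + v * (1 / Real.sin v) * Real.exp (-v * Real.cot v))) := by
        simp only [Real.cot_eq_cos_div_sin]
        fun_prop
      exact this.aestronglyMeasurable
    · rw [uIoc_of_le Real.pi_pos.le]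
      refine (MeasureTheory.ae_restrict_iff' measurableSet_Ioc).2 (Eventually.of_forall ?_)
      intro v hv
      have hsin : 0 ≤ Real.sin v := Real.sin_nonneg_of_nonneg_of_le_pi hv.1.le hv.2
      have hg : 0 ≤ v * (1 / Real.sin v) * Real.exp (-v * Real.cot v) := by
        have := hv.1; positivity
      beta_reduce
      rw [Real.norm_of_nonneg (by positivity), Real.norm_of_nonneg (by positivity)]
      exact one_div_le_one_div_of_le hx (le_add_of_nonneg_right hg)
  have hzero : Tendsto Φ (𝓝[>] 0) (𝓝 (F (-1)).im) := by
    have hγ := tendsto_hankelCurve_zero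
    have hFc : ContinuousAt F (-1) := (hF (-1) (by simpa using hreal (-1))).continuousAt
    have harg : ContinuousAt Complex.arg (w - -1) :=
      Complex.continuousAt_arg (Or.inl (by simp; linarith))
    have h0 : Complex.arg (w - -1) = 0 := by
      have : (w : ℂ) - -1 = ((w + 1 : ℝ) : ℂ) := by push_cast; ring
      rw [this, Complex.arg_ofReal_of_nonneg (by linarith)]
    have h := ((Complex.continuous_im.tendsto _).comp (hFc.tendsto.comp hγ)).sub
      ((harg.tendsto.comp (hγ.const_sub (w : ℂ))).const_mul c)
    rw [h0, mul_zero, sub_zero] at h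
    exact h
  have hpi : Tendsto Φ (𝓝[<] π) (𝓝 ((F (-1)).im - c * -π)) := by
    refine Tendsto.sub ?_ ((tendsto_arg_sub_hankelCurve_pi w).const_mul c)
    have hre := tendsto_re_hankelCurve_pi
    have hexp : Tendsto (fun u : ℝ => u * Real.exp u - x) atTop atTop :=
      tendsto_atTop_add_const_right _ _ (tendsto_id.atTop_mul_atTop₀ Real.tendsto_exp_atTop)
    have hsub : Tendsto (fun u : ℝ => u - w) atTop atTop :=
      tendsto_atTop_add_const_right _ _ tendsto_id
    have hlim := (((hexp.inv_tendsto_atTop.add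
      (hsub.inv_tendsto_atTop.const_mul c)).mul_const π).comp hre)
    rw [mul_zero, add_zero, zero_mul] at hlim
    rw [tendsto_iff_norm_sub_tendsto_zero]
    refine squeeze_zero' (Eventually.of_forall fun v => norm_nonneg _) ?_ hlim
    filter_upwards [hre.eventually_gt_atTop w, Ioo_mem_nhdsLT Real.pi_pos] with v hv hv0
    have hS : (hankelCurve v).im ∈ Ioo (-π) π :=
      ⟨by simp [hankelCurve]; linarith [hv0.1, hv0.2], hv0.2⟩
    refine le_trans ?_ (hbound _ hS hv)
    rw [← hFim (hankelCurve v).re, ← Complex.sub_im, Real.norm_eq_abs]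
    exact Complex.abs_im_le_norm _
  rw [intervalIntegral.integral_eq_sub_of_hasDerivAt_of_tendsto Real.pi_pos hΦderiv hint hzero hpi]
  ring

/-- Stieltjes integral representation of the derivative of Lambert W on `(0, ∞)`. -/
theorem lambertW_deriv_stieltjes (W : ℝ → ℝ)
    (hW : ∀ x > 0, W x * Real.exp (W x) = x) (hWpos : ∀ x > 0, W x > 0) :
    ∀ x > (0:ℝ),
      HasDerivAt W
        ((1 / π) * ∫ v in (0:ℝ)..π,
          1 / (x + v * (1 / Real.sin v) * Real.exp (-v * Real.cot v))) x := by
  intro x hx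
  have h := intervalIntegral_stieltjes (hWpos x hx)
  rw [hW x hx] at h
  rw [h, ← mul_assoc, one_div_mul_cancel Real.pi_ne_zero, one_mul]
  exact hasDerivAt_of_mul_exp_eq hW hWpos hx
end

section
/- Let W : ℝ → ℝ satisfy W(x) * exp(W(x)) = x and W(x) > 0 for all x > 0. Then for all x > 0, W(x) = log(1 + (x/π) * ∫ from 0 to π of (v^2 + (1 - v*cot v)^2) / (v*csc(v) * (v*csc(v) + x*exp(v*cot v))) dv). -/
open Real

open Filter Set Topology ComplexConjugate

/-- In the strip `|Im w| < π`, the equation `w * exp w = a * exp a` with `a > 0` has the only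
solution `w = a`. -/
lemma eq_of_mul_exp_eq {a : ℝ} (ha : 0 < a) {w : ℂ} (hw : |w.im| < π)
    (h : w * Complex.exp w = a * Complex.exp a) : w = a := by
  have hw' : w = ((a * Real.exp a * Real.exp (-w.re) : ℝ) : ℂ) *
      Complex.exp (-(w.im * Complex.I)) := by
    have h1 : Complex.exp w * (Complex.exp (-w.re) * Complex.exp (-(w.im * Complex.I))) = 1 := by
      rw [← Complex.exp_add, ← Complex.exp_add, ← Complex.exp_zero]
      congr 1
      linear_combination (Complex.re_add_im w).symm
    push_cast
    linear_combination (-w) * h1 + Complex.exp (-w.re) * Complex.exp (-(w.im * Complex.I)) * h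
  have him : w.im = -(a * Real.exp a * Real.exp (-w.re) * Real.sin w.im) := by
    conv_lhs => rw [hw']
    rw [Complex.im_ofReal_mul, Complex.exp_im]
    simp
  have hpos : 0 < a * Real.exp a * Real.exp (-w.re) := by positivity
  rw [abs_lt] at hw
  have hv : w.im = 0 := by
    rcases lt_trichotomy w.im 0 with hlt | heq | hgt
    · have := Real.sin_neg_of_neg_of_neg_pi_lt hlt hw.1
      nlinarith
    · exact heq
    · have := Real.sin_pos_of_pos_of_lt_pi hgt hw.2
      nlinarith
  have hre : w = (w.re : ℂ) := Complex.ext rfl (by simpa using hv)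
  rw [hre] at h ⊢
  have hr : w.re * Real.exp w.re = a * Real.exp a := by exact_mod_cast h
  have hr0 : 0 < w.re :=
    pos_of_mul_pos_left (hr.symm ▸ by positivity : 0 < w.re * Real.exp w.re) (Real.exp_pos _).le
  rw [Complex.ofReal_inj]
  rcases lt_trichotomy w.re a with hlt | heq | hgt
  · exact absurd hr (mul_lt_mul'' hlt (Real.exp_lt_exp.2 hlt) hr0.le (Real.exp_pos _).le).ne
  · exact heq
  · exact absurd hr (mul_lt_mul'' hgt (Real.exp_lt_exp.2 hgt) ha.le (Real.exp_pos _).le).ne'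

/-- The function `(1 + w) exp w / (w (w exp w - x))` with its principal parts at the poles `0` and
`a` removed, where `x = a exp a`. -/
noncomputable def regularPart (a x : ℝ) (w : ℂ) : ℂ :=
  (1 + w) * Complex.exp w / (w * (w * Complex.exp w - x)) - 1 / (a * (w - a)) + 1 / (x * w)

lemma regularPart_conj (a x : ℝ) (w : ℂ) :
    regularPart a x (conj w) = conj (regularPart a x w) := by
  simp [regularPart, ← Complex.exp_conj]

/-- After removing its singularities, `regularPart` has a primitive on the strip `|Im w| < π`. -/
lemma exists_primitive_regularPart {a : ℝ} (ha : 0 < a) :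
    ∃ P G : ℂ → ℂ, (∀ w : ℂ, |w.im| < π → HasDerivAt P (G w) w) ∧
      ∀ w : ℂ, |w.im| < π → w ≠ 0 → w ≠ a → G w = regularPart a (a * Real.exp a) w := by
  set S : Set ℂ := {w | |w.im| < π} with hS
  have hSo : IsOpen S := isOpen_lt (by fun_prop) continuous_const
  have hSc : Convex ℝ S := by
    have : S = Complex.imLm ⁻¹' Ioo (-π) π := by
      ext w; simp [hS, abs_lt]
    rw [this]
    exact (convex_Ioo _ _).linear_preimage _
  have haS : (a : ℂ) ∈ S := by simp [hS, Real.pi_pos]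
  have h0S : (0 : ℂ) ∈ S := by simp [hS, Real.pi_pos]
  have ha0 : (a : ℂ) ≠ 0 := by exact_mod_cast ha.ne'
  set x : ℝ := a * Real.exp a with hx
  have hx0 : (x : ℂ) ≠ 0 := by exact_mod_cast (by positivity : x ≠ 0)
  set f : ℂ → ℂ := fun w => w * Complex.exp w - x with hf
  have hfa : f a = 0 := by simp [hf, hx]
  have hfd : Differentiable ℂ f := by fun_prop
  set q := dslope f a with hq
  have hqd : DifferentiableOn ℂ q S :=
    (Complex.differentiableOn_dslope (hSo.mem_nhds haS)).2 hfd.differentiableOn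
  have hq_of_ne : ∀ w : ℂ, w ≠ a → q w = f w / (w - a) := by
    intro w hw
    rw [hq, dslope_of_ne _ hw, slope_def_field, hfa, sub_zero]
  have hqa : q a = (1 + a) * Complex.exp a := by
    rw [hq, dslope_same]
    have : HasDerivAt f (1 * Complex.exp a + a * Complex.exp a) a :=
      ((hasDerivAt_id _).mul (Complex.hasDerivAt_exp _)).sub_const _
    rw [this.deriv]; ring
  have h1a : (1 + a : ℂ) ≠ 0 := by exact_mod_cast (by positivity : (1 + a : ℝ) ≠ 0)
  have hf0 : ∀ w ∈ S, w ≠ a → f w ≠ 0 := by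
    intro w hw hwa h
    refine hwa (eq_of_mul_exp_eq ha hw ?_)
    rw [sub_eq_zero.1 h, hx]; push_cast; rfl
  have hq0 : ∀ w ∈ S, q w ≠ 0 := by
    intro w hw
    by_cases hwa : w = a
    · rw [hwa, hqa]
      exact mul_ne_zero h1a (Complex.exp_ne_zero _)
    · rw [hq_of_ne w hwa]
      exact div_ne_zero (hf0 w hw hwa) (sub_ne_zero.2 hwa)
  set H : ℂ → ℂ := fun w => (1 + w) * Complex.exp w / q w with hH
  have hHd : DifferentiableOn ℂ H S :=
    DifferentiableOn.div (by fun_prop) hqd hq0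
  have hHa : H a = 1 := by
    simp only [hH, hqa]
    exact div_self (mul_ne_zero h1a (Complex.exp_ne_zero _))
  have hH0 : H 0 = a / x := by
    simp only [hH, hq_of_ne 0 ha0.symm, hf]
    field_simp
    simp [hx0]
  obtain ⟨P, hP⟩ := hSc.exists_forall_hasDerivWithinAt (𝕜 := ℂ)
    (f := fun w => (1 / a : ℂ) * (dslope H a w - dslope H 0 w))
    ((((Complex.differentiableOn_dslope (hSo.mem_nhds haS)).2 hHd).sub
      ((Complex.differentiableOn_dslope (hSo.mem_nhds h0S)).2 hHd)).const_mul _)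
  refine ⟨P, _, fun w hw => (hP w hw).hasDerivAt (hSo.mem_nhds hw), fun w hw hw0 hwa => ?_⟩
  have hfw := hf0 w hw hwa
  have hwa' := sub_ne_zero.2 hwa
  rw [dslope_of_ne _ hwa, dslope_of_ne _ hw0, slope_def_field, slope_def_field, hHa, hH0]
  simp only [hH, hq_of_ne w hwa, regularPart]
  change _ = (1 + w) * Complex.exp w / (w * f w) - 1 / (a * (w - a)) + 1 / (x * w)
  rw [sub_zero]
  field_simp
  ring

lemma norm_regularPart_le {a x : ℝ} (ha : 0 < a) (hx : 0 < x) {w : ℂ} (h1 : 1 ≤ w.re)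
    (h2a : 2 * a ≤ w.re) (h2x : 2 * x ≤ w.re) :
    ‖regularPart a x w‖ ≤ (4 + 2 / a + 1 / x) / w.re := by
  have hr : 0 < w.re := by linarith
  have hw : w.re ≤ ‖w‖ := Complex.re_le_norm w
  have hw0 : 0 < ‖w‖ := by linarith
  have he : 1 ≤ Real.exp w.re := Real.one_le_exp hr.le
  have h3 : ‖w‖ * Real.exp w.re / 2 ≤ ‖w * Complex.exp w - x‖ := by
    have := norm_sub_norm_le (w * Complex.exp w) (x : ℂ)
    rw [norm_mul, Complex.norm_exp, Complex.norm_real, Real.norm_of_nonneg hx.le] at this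
    nlinarith
  have h4 : ‖(1 + w) * Complex.exp w / (w * (w * Complex.exp w - x))‖ ≤ 4 / w.re := by
    rw [norm_div, norm_mul, norm_mul, Complex.norm_exp]
    have : ‖1 + w‖ ≤ 2 * ‖w‖ := by
      have := norm_add_le 1 w
      rw [norm_one] at this
      linarith
    calc _ ≤ 2 * ‖w‖ * Real.exp w.re / (‖w‖ * (‖w‖ * Real.exp w.re / 2)) := by gcongr
      _ = 4 / ‖w‖ := by field_simp; norm_num
      _ ≤ _ := by gcongr
  have h5 : ‖1 / (a * (w - a) : ℂ)‖ ≤ 2 / a / w.re := by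
    rw [norm_div, norm_mul, norm_one, Complex.norm_real, Real.norm_of_nonneg ha.le]
    have : w.re / 2 ≤ ‖w - a‖ := by
      have := Complex.re_le_norm (w - a)
      simp only [Complex.sub_re, Complex.ofReal_re] at this
      linarith
    calc _ ≤ 1 / (a * (w.re / 2)) := by gcongr
      _ = _ := by field_simp
  have h6 : ‖1 / (x * w : ℂ)‖ ≤ 1 / x / w.re := by
    rw [norm_div, norm_mul, norm_one, Complex.norm_real, Real.norm_of_nonneg hx.le, div_div]
    gcongr
  calc _ ≤ 4 / w.re + 2 / a / w.re + 1 / x / w.re :=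
        norm_add_le_of_le (norm_sub_le_of_le h4 h5) h6
    _ = _ := by ring

/-- The curve `v ↦ -v cot v + i v`, which `w ↦ w exp w` maps to the negative real axis. -/
noncomputable def cutCurve (v : ℝ) : ℂ := ⟨-(v * Real.cot v), v⟩

lemma hasDerivAt_cutCurve {v : ℝ} (hv : Real.sin v ≠ 0) :
    HasDerivAt cutCurve ⟨-(Real.cot v - v * (1 + Real.cot v ^ 2)), 1⟩ v := by
  have h1 : HasDerivAt (fun v => v * Real.cot v) (Real.cot v - v * (1 + Real.cot v ^ 2)) v := by
    have h2 : HasDerivAt (fun v => v * (Real.cos v / Real.sin v))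
        (Real.cot v - v * (1 + Real.cot v ^ 2)) v := by
      refine ((hasDerivAt_id v).mul
        ((Real.hasDerivAt_cos v).div (Real.hasDerivAt_sin v) hv)).congr_deriv ?_
      simp only [Real.cot_eq_cos_div_sin, id, Pi.div_apply]
      field_simp
      ring
    simpa only [Real.cot_eq_cos_div_sin] using h2
  have h3 := (h1.neg.ofReal_comp).add ((hasDerivAt_id v).ofReal_comp.mul_const Complex.I)
  have hfun : cutCurve = fun u : ℝ => ((-(u * Real.cot u) : ℝ) : ℂ) + (u : ℂ) * Complex.I :=
    funext fun _ => Complex.mk_eq_add_mul_I _ _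
  rw [hfun]
  exact h3.congr_deriv (Complex.mk_eq_add_mul_I _ _).symm

lemma cutCurve_mul_exp {v : ℝ} (hv : Real.sin v ≠ 0) :
    cutCurve v * Complex.exp (cutCurve v) =
      ((-(v / Real.sin v * Real.exp (-(v * Real.cot v))) : ℝ) : ℂ) := by
  have hs := Real.sin_sq_add_cos_sq v
  apply Complex.ext
  · simp only [Complex.mul_re, Complex.exp_re, Complex.exp_im, cutCurve, Complex.ofReal_re,
      Real.cot_eq_cos_div_sin]
    field_simp
    linear_combination (-v) * hs
  · simp only [Complex.mul_im, Complex.exp_re, Complex.exp_im, cutCurve, Complex.ofReal_im,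
      Real.cot_eq_cos_div_sin]
    field_simp
    ring

/-- Pulling back `d(w exp w) / (w (w exp w - x))` along `cutCurve` produces the integrand. -/
lemma im_kernel_cutCurve {x v : ℝ} (hx : 0 < x) (hv0 : 0 < v) (hvπ : v < π) :
    ((1 + cutCurve v) * Complex.exp (cutCurve v) /
      (cutCurve v * (cutCurve v * Complex.exp (cutCurve v) - x)) *
        ⟨-(Real.cot v - v * (1 + Real.cot v ^ 2)), 1⟩).im =
      -((v ^ 2 + (1 - v * Real.cot v) ^ 2) /
          (v * (1 / Real.sin v) *
            (v * (1 / Real.sin v) + x * Real.exp (v * Real.cot v)))) := by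
  have hs : 0 < Real.sin v := Real.sin_pos_of_pos_of_lt_pi hv0 hvπ
  set t : ℝ := v / Real.sin v * Real.exp (-(v * Real.cot v)) with ht
  have ht0 : 0 < t := by positivity
  set N : ℝ := v ^ 2 + (1 - v * Real.cot v) ^ 2 with hN
  have hw0 : cutCurve v ≠ 0 := fun h => hv0.ne' (by simpa [cutCurve] using congrArg Complex.im h)
  have hv0' : (v : ℂ) ≠ 0 := by exact_mod_cast hv0.ne'
  have htx : ((-t - x : ℝ) : ℂ) ≠ 0 := by
    exact_mod_cast (by linarith : -t - x < 0).ne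
  have hmul : (v : ℂ) * ((1 + cutCurve v) * ⟨-(Real.cot v - v * (1 + Real.cot v ^ 2)), 1⟩) =
      cutCurve v * N := by
    apply Complex.ext <;>
    simp only [cutCurve, hN, Complex.mul_re, Complex.mul_im, Complex.add_re, Complex.add_im,
      Complex.one_re, Complex.one_im, Complex.ofReal_re, Complex.ofReal_im] <;>
    ring
  have key : (1 + cutCurve v) * Complex.exp (cutCurve v) /
      (cutCurve v * (cutCurve v * Complex.exp (cutCurve v) - x)) *
        ⟨-(Real.cot v - v * (1 + Real.cot v ^ 2)), 1⟩ =
      ((N / (v * (-t - x)) : ℝ) : ℂ) * Complex.exp (cutCurve v) := by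
    rw [cutCurve_mul_exp hs.ne', ← ht, ← Complex.ofReal_sub]
    push_cast at htx ⊢
    field_simp
    linear_combination hmul
  rw [key, Complex.im_ofReal_mul, Complex.exp_im]
  have he : Real.exp (-(v * Real.cot v)) * Real.exp (v * Real.cot v) = 1 := by
    rw [← Real.exp_add]; simp
  simp only [cutCurve]
  have h1 : -t - x ≠ 0 := by linarith
  rw [show Real.exp (v * Real.cot v) = (Real.exp (-(v * Real.cot v)))⁻¹ by
    rw [Real.exp_neg, inv_inv]]
  have h2 : v + x * Real.sin v * (Real.exp (-(v * Real.cot v)))⁻¹ ≠ 0 := by positivity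
  have h3 : -t - x = -((v * (1 / Real.sin v) + x * (Real.exp (-(v * Real.cot v)))⁻¹)
      * Real.exp (-(v * Real.cot v))) := by
    rw [ht]; field_simp; ring
  rw [h3]
  field_simp

lemma tendsto_cutCurve_zero : Tendsto cutCurve (𝓝[>] 0) (𝓝 (-1)) := by
  have hc : ContinuousAt
      (fun v : ℝ => -((Real.cos v / Real.sinc v : ℝ) : ℂ) + v * Complex.I) 0 := by
    have : ContinuousAt (fun v : ℝ => Real.cos v / Real.sinc v) 0 :=
      Real.continuous_cos.continuousAt.div Real.continuous_sinc.continuousAt (by simp)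
    have := Complex.continuous_ofReal.continuousAt.comp this
    fun_prop
  have h := hc.tendsto.mono_left (nhdsWithin_le_nhds (s := Ioi 0))
  simp only [Real.cos_zero, Real.sinc_zero, div_one, Complex.ofReal_one, Complex.ofReal_zero,
    zero_mul, add_zero] at h
  refine h.congr' ?_
  filter_upwards [self_mem_nhdsWithin] with v hv
  have hv' : v ≠ 0 := (mem_Ioi.1 hv).ne'
  rw [Real.sinc_of_ne_zero hv']
  apply Complex.ext
  · simp only [cutCurve, Real.cot_eq_cos_div_sin]
    simp [-Complex.ofReal_cos, -Complex.ofReal_sin, -Complex.ofReal_div]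
    field_simp
  · simp [cutCurve, -Complex.ofReal_cos, -Complex.ofReal_sin, -Complex.ofReal_div]

lemma tendsto_cutCurve_re_pi : Tendsto (fun v => (cutCurve v).re) (𝓝[<] π) atTop := by
  have h1 : Tendsto (fun v => -(v * Real.cos v)) (𝓝[<] π) (𝓝 π) := by
    have : Continuous fun v => -(v * Real.cos v) := by fun_prop
    simpa using (this.tendsto π).mono_left (nhdsWithin_le_nhds (s := Iio π))
  have h2 : Tendsto Real.sin (𝓝[<] π) (𝓝[>] 0) := by
    refine tendsto_nhdsWithin_iff.2 ⟨?_, ?_⟩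
    · simpa using (Real.continuous_sin.tendsto π).mono_left (nhdsWithin_le_nhds (s := Iio π))
    · filter_upwards [Ioo_mem_nhdsLT Real.pi_pos] with v hv
      exact Real.sin_pos_of_mem_Ioo hv
  refine (h1.pos_mul_atTop Real.pi_pos h2.inv_tendsto_nhdsGT_zero).congr fun v => ?_
  simp only [cutCurve, Real.cot_eq_cos_div_sin, Pi.inv_apply]
  ring

/-- The imaginary part of a branch of `log (w - b)` that is defined on the upper half plane,
taken along `cutCurve`. -/
noncomputable def argAlong (b v : ℝ) : ℝ := (Complex.log (-Complex.I * (cutCurve v - b))).im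

lemma hasDerivAt_argAlong (b : ℝ) {v : ℝ} (hv0 : 0 < v) (hvπ : v < π) :
    HasDerivAt (argAlong b)
      ((⟨-(Real.cot v - v * (1 + Real.cot v ^ 2)), 1⟩ / (cutCurve v - b) : ℂ).im) v := by
  have hs : 0 < Real.sin v := Real.sin_pos_of_pos_of_lt_pi hv0 hvπ
  have h := (((hasDerivAt_cutCurve hs.ne').sub_const (b : ℂ)).const_mul (-Complex.I)).clog_real
    (Or.inl (by simpa [cutCurve] using hv0))
  refine (Complex.imCLM.hasFDerivAt.comp_hasDerivAt v h).congr_deriv ?_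
  rw [mul_div_mul_left _ _ (neg_ne_zero.2 Complex.I_ne_zero)]
  rfl

lemma tendsto_argAlong_zero {b : ℝ} (hb : 0 ≤ b) :
    Tendsto (argAlong b) (𝓝[>] 0) (𝓝 (π / 2)) := by
  have h1 : Tendsto (fun v => -Complex.I * (cutCurve v - b)) (𝓝[>] 0)
      (𝓝 (-Complex.I * (-1 - b))) := (tendsto_cutCurve_zero.sub_const _).const_mul _
  have h2 : -Complex.I * (-1 - b) = ((1 + b : ℝ) : ℂ) * Complex.I := by push_cast; ring
  rw [h2] at h1
  have hb' : 0 < 1 + b := by linarith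
  have h3 := (Complex.continuous_im.tendsto _).comp
    ((continuousAt_clog (Or.inr (by simpa using hb'.ne'))).tendsto.comp h1)
  rwa [Complex.log_im, Complex.arg_real_mul _ hb', Complex.arg_I] at h3

lemma tendsto_argAlong_pi (b : ℝ) : Tendsto (argAlong b) (𝓝[<] π) (𝓝 (-(π / 2))) := by
  set g : ℝ → ℂ := fun v => -Complex.I *
    (-(v * Real.cos v : ℝ) + (v * Real.sin v : ℝ) * Complex.I - (b * Real.sin v : ℝ)) with hg
  have hgc : Continuous g := by fun_prop
  have hgπ : g π = (π : ℝ) * -Complex.I := by simp [hg, mul_comm]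
  have h1 := (hgc.tendsto π).mono_left (nhdsWithin_le_nhds (s := Iio π))
  rw [hgπ] at h1
  have h3 := (Complex.continuous_im.tendsto _).comp
    ((continuousAt_clog (Or.inr (by simp [Real.pi_ne_zero]))).tendsto.comp h1)
  rw [Complex.log_im, Complex.arg_real_mul _ Real.pi_pos, Complex.arg_neg_I] at h3
  refine h3.congr' ?_
  filter_upwards [Ioo_mem_nhdsLT Real.pi_pos] with v hv
  have hs := Real.sin_pos_of_mem_Ioo hv
  have h4 : g v = (Real.sin v : ℝ) * (-Complex.I * (cutCurve v - b)) := by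
    apply Complex.ext
    · simp [hg, cutCurve, -Complex.ofReal_cos, -Complex.ofReal_sin]
      ring
    · simp [hg, cutCurve, -Complex.ofReal_cos, -Complex.ofReal_sin, Real.cot_eq_cos_div_sin]
      field_simp
      ring
  simp only [Function.comp_apply, argAlong, Complex.log_im]
  rw [h4, Complex.arg_real_mul _ hs]

lemma intervalIntegrable_integrand {x : ℝ} (hx : 0 < x) :
    IntervalIntegrable (fun v => (v ^ 2 + (1 - v * Real.cot v) ^ 2) /
          (v * (1 / Real.sin v) *
            (v * (1 / Real.sin v) + x * Real.exp (v * Real.cot v)))) MeasureTheory.volume 0 π := by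
  rw [intervalIntegrable_iff_integrableOn_Ioo_of_le Real.pi_pos.le]
  refine MeasureTheory.IntegrableOn.of_bound (by simp) ?_ 5 ?_
  · refine Measurable.aestronglyMeasurable ?_
    simp only [Real.cot_eq_cos_div_sin]
    fun_prop
  refine (MeasureTheory.ae_restrict_iff' measurableSet_Ioo).2 (.of_forall fun v hv => ?_)
  have hs := Real.sin_pos_of_mem_Ioo hv
  have hv0 := hv.1
  have hle : Real.sin v ≤ v := Real.sin_le hv0.le
  rw [Real.norm_of_nonneg (by positivity)]
  calc _ ≤ (v ^ 2 + (1 - v * Real.cot v) ^ 2) /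
          (v * (1 / Real.sin v) * (v * (1 / Real.sin v))) := by
        gcongr
        exact le_add_of_nonneg_right (by positivity)
    _ = Real.sin v ^ 2 + (Real.sin v / v - Real.cos v) ^ 2 := by
        rw [Real.cot_eq_cos_div_sin]; field_simp
    _ ≤ 5 := by
        have h1 : Real.sin v / v ≤ 1 := (div_le_one hv0).2 hle
        have h2 : 0 ≤ Real.sin v / v := by positivity
        nlinarith [Real.sin_sq_add_cos_sq v, Real.neg_one_le_cos v, Real.cos_le_one v]

/-- The value of the integral at `x = a exp a`, by integrating along `cutCurve` and its conjugate. -/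
lemma integral_integrand {a : ℝ} (ha : 0 < a) :
    ∫ v in (0:ℝ)..π, (v ^ 2 + (1 - v * Real.cot v) ^ 2) / (v * (1 / Real.sin v) *
      (v * (1 / Real.sin v) + a * Real.exp a * Real.exp (v * Real.cot v))) =
      π / a - π / (a * Real.exp a) := by
  obtain ⟨P, G, hP, hG⟩ := exists_primitive_regularPart ha
  set x : ℝ := a * Real.exp a with hx
  have hx0 : 0 < x := by positivity
  have habs : ∀ v ∈ Ioo 0 π, |v| < π := fun v hv => by rw [abs_of_pos hv.1]; exact hv.2
  have hderiv : ∀ v ∈ Ioo 0 π, HasDerivAt (fun v => -(1 / 2) * (P (cutCurve v) -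
      P (conj (cutCurve v))).im - 1 / a * argAlong a v + 1 / x * argAlong 0 v)
      ((v ^ 2 + (1 - v * Real.cot v) ^ 2) / (v * (1 / Real.sin v) *
        (v * (1 / Real.sin v) + x * Real.exp (v * Real.cot v)))) v := by
    intro v hv
    have hs := Real.sin_pos_of_mem_Ioo hv
    have hv0 := hv.1
    set w := cutCurve v with hw
    set w' : ℂ := ⟨-(Real.cot v - v * (1 + Real.cot v ^ 2)), 1⟩ with hw'
    have hconj : |(conj w).im| < π := by
      rw [Complex.conj_im, abs_neg]
      exact habs v hv
    have hne : ∀ z : ℂ, z.im ≠ 0 → ∀ b : ℝ, z ≠ b := fun z hz b h => hz (by simp [h])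
    have hcurve : HasDerivAt cutCurve w' v := hasDerivAt_cutCurve hs.ne'
    have h1 : HasDerivAt (fun v => P (cutCurve v)) (G w * w') v :=
      HasDerivAt.comp (h := cutCurve) v (hP w (habs v hv)) hcurve
    have h2 : HasDerivAt (fun v => P (conj (cutCurve v))) (G (conj w) * conj w') v := by
      have hc : HasDerivAt (fun v => conj (cutCurve v)) (conj w') v :=
        Complex.conjCLE.hasFDerivAt.comp_hasDerivAt v hcurve
      exact HasDerivAt.comp (h := fun v => conj (cutCurve v)) v (hP (conj w) hconj) hc
    have h3 : HasDerivAt (fun v => (P (cutCurve v) - P (conj (cutCurve v))).im)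
        (G w * w' - G (conj w) * conj w').im v :=
      Complex.imCLM.hasFDerivAt.comp_hasDerivAt v (h1.sub h2)
    have hw0 : w.im ≠ 0 := hv0.ne'
    have hGc : G (conj w) = conj (G w) := by
      rw [hG w (habs v hv) (by simpa using hne w hw0 0) (hne w hw0 a),
        hG (conj w) hconj (by simpa using hne w hw0 0)
          (hne _ (by simpa using hw0) a), regularPart_conj]
    rw [hGc, ← map_mul, hG w (habs v hv) (by simpa using hne w hw0 0) (hne w hw0 a)] at h3
    refine (((h3.const_mul (-(1 / 2))).sub
      ((hasDerivAt_argAlong a hv0 hv.2).const_mul (1 / a))).add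
      ((hasDerivAt_argAlong 0 hv0 hv.2).const_mul (1 / x))).congr_deriv ?_
    rw [← neg_eq_iff_eq_neg.2 (im_kernel_cutCurve hx0 hv0 hv.2), ← hw, ← hw', Complex.sub_im,
      Complex.conj_im, ← Complex.im_ofReal_mul, ← Complex.im_ofReal_mul]
    have h5 : regularPart a x w * w' =
        (1 + w) * Complex.exp w / (w * (w * Complex.exp w - x)) * w'
        - ((1 / a : ℝ) : ℂ) * (w' / (w - a)) + ((1 / x : ℝ) : ℂ) * (w' / (w - (0 : ℝ))) := by
      simp only [regularPart, Complex.ofReal_zero, sub_zero, div_eq_mul_inv, mul_inv,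
        Complex.ofReal_mul, Complex.ofReal_inv, Complex.ofReal_one]
      ring
    rw [h5, Complex.add_im, Complex.sub_im]
    ring
  have hzero : Tendsto (fun v => -(1 / 2) * (P (cutCurve v) -
      P (conj (cutCurve v))).im - 1 / a * argAlong a v + 1 / x * argAlong 0 v) (𝓝[>] 0)
      (𝓝 (-(1 / 2) * 0 - 1 / a * (π / 2) + 1 / x * (π / 2))) := by
    refine ((Tendsto.const_mul _ ?_).sub ((tendsto_argAlong_zero ha.le).const_mul _)).add
      ((tendsto_argAlong_zero le_rfl).const_mul _)
    have hPc : ContinuousAt P (-1) := (hP (-1) (by simp [Real.pi_pos])).continuousAt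
    have h1 := hPc.tendsto.comp tendsto_cutCurve_zero
    have h2 : Tendsto (fun v => P (conj (cutCurve v))) (𝓝[>] 0) (𝓝 (P (-1))) := by
      refine hPc.tendsto.comp ?_
      have h3 := (Complex.continuous_conj.tendsto (-1)).comp tendsto_cutCurve_zero
      rwa [map_neg, map_one] at h3
    simpa using! (Complex.continuous_im.tendsto _).comp (h1.sub h2)
  have hpi : Tendsto (fun v => -(1 / 2) * (P (cutCurve v) -
      P (conj (cutCurve v))).im - 1 / a * argAlong a v + 1 / x * argAlong 0 v) (𝓝[<] π)
      (𝓝 (-(1 / 2) * 0 - 1 / a * (-(π / 2)) + 1 / x * (-(π / 2)))) := by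
    refine ((Tendsto.const_mul _ ?_).sub ((tendsto_argAlong_pi a).const_mul _)).add
      ((tendsto_argAlong_pi 0).const_mul _)
    have hlim : Tendsto (fun v => (4 + 2 / a + 1 / x) / (cutCurve v).re * (2 * π)) (𝓝[<] π)
        (𝓝 0) := by
      simpa using (tendsto_cutCurve_re_pi.const_div_atTop (4 + 2 / a + 1 / x)).mul_const (2 * π)
    refine squeeze_zero_norm' ?_ hlim
    filter_upwards [Ioo_mem_nhdsLT Real.pi_pos, tendsto_cutCurve_re_pi.eventually_ge_atTop 1,
      tendsto_cutCurve_re_pi.eventually_gt_atTop (2 * a),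
      tendsto_cutCurve_re_pi.eventually_ge_atTop (2 * x)] with v hv hv1 hva hvx
    set w := cutCurve v with hw
    set T : Set ℂ := {z | z.re = w.re ∧ |z.im| < π} with hT
    have hTc : Convex ℝ T := by
      have : T = Complex.reLm ⁻¹' {w.re} ∩ Complex.imLm ⁻¹' Ioo (-π) π := by
        ext z; simp [hT, abs_lt]
      rw [this]
      exact ((convex_singleton _).linear_preimage _).inter ((convex_Ioo _ _).linear_preimage _)
    have hmem : w ∈ T := ⟨rfl, habs v hv⟩
    have hmem' : conj w ∈ T := ⟨by simp, by
      rw [Complex.conj_im, abs_neg]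
      exact habs v hv⟩
    have hbound := hTc.norm_image_sub_le_of_norm_hasDerivWithin_le (f := P) (f' := G)
      (C := (4 + 2 / a + 1 / x) / w.re) (fun z hz => (hP z hz.2).hasDerivWithinAt)
      (fun z hz => by
        have hz1 : 1 ≤ z.re := hz.1 ▸ hv1
        have hza : 2 * a < z.re := hz.1 ▸ hva
        rw [hG z hz.2 (fun h => by simp [h] at hz1; linarith)
          (fun h => by simp [h] at hza; linarith), ← hz.1]
        exact norm_regularPart_le ha hx0 hz1 hza.le (hz.1 ▸ hvx)) hmem' hmem
    have hwr : 0 < w.re := by linarith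
    calc _ ≤ ‖P w - P (conj w)‖ := Complex.abs_im_le_norm _
      _ ≤ _ := hbound
      _ ≤ _ := by
        gcongr
        rw [Complex.sub_conj, norm_mul, Complex.norm_I, Complex.norm_real, Real.norm_eq_abs,
          abs_mul, abs_two, mul_one]
        exact mul_le_mul_of_nonneg_left (habs v hv).le zero_le_two
  rw [intervalIntegral.integral_eq_sub_of_hasDerivAt_of_tendsto Real.pi_pos hderiv
    (intervalIntegrable_integrand hx0) hzero hpi]
  ring

/-- Logarithmic integral representation of Lambert W on `(0, ∞)`. -/
theorem lambertW_eq_log_integral (W : ℝ → ℝ)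
    (hW : ∀ x > 0, W x * Real.exp (W x) = x) (hWpos : ∀ x > 0, W x > 0) :
    ∀ x > (0:ℝ),
      W x = Real.log (1 + (x / π) * ∫ v in (0:ℝ)..π,
        (v ^ 2 + (1 - v * Real.cot v) ^ 2) /
          (v * (1 / Real.sin v) *
            (v * (1 / Real.sin v) + x * Real.exp (v * Real.cot v)))) := by
  intro x hx
  have ha := hWpos x hx
  have h := integral_integrand ha
  rw [hW x hx] at h
  rw [h]
  have hexp : Real.exp (W x) = x / W x := by
    rw [eq_div_iff ha.ne', mul_comm]
    exact hW x hx
  have hval : 1 + x / π * (π / W x - π / x) = Real.exp (W x) := by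
    rw [hexp]
    field_simp
    ring
  rw [hval, Real.log_exp]
end

section
/- Let W : ℝ → ℝ satisfy W(x) * exp(W(x)) = x and W(x) > 0 for all x > 0. Then for all x > 0, 1/W(x) - 1/x = (1/π) * ∫ from 0 to π of (v^2 + (1 - v*cot v)^2) / (v*csc(v) * (v*csc(v) + x*exp(v*cot v))) dv. -/
open Real
section

open Set Filter Topology MeasureTheory

/-- The horizontal strip `|Im z| < π`. -/
def openStrip : Set ℂ := {z | z.im ∈ Ioo (-π) π}

lemma isOpen_openStrip : IsOpen openStrip := isOpen_Ioo.preimage Complex.continuous_im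

lemma convex_openStrip : Convex ℝ openStrip := (convex_Ioo (-π) π).linear_preimage Complex.imLm

lemma ofReal_mem_openStrip (a : ℝ) : (a : ℂ) ∈ openStrip := by
  simp [openStrip, Real.pi_pos]

lemma mul_exp_lt_mul_exp {a b : ℝ} (hb : 0 < b) (h : a < b) :
    a * Real.exp a < b * Real.exp b := by
  rcases le_or_gt a 0 with ha | ha
  · exact (mul_nonpos_of_nonpos_of_nonneg ha (Real.exp_pos a).le).trans_lt
      (mul_pos hb (Real.exp_pos b))
  · exact mul_lt_mul'' h (Real.exp_lt_exp.2 h) ha.le (Real.exp_pos a).le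

/-- `w` is the only preimage of `w * exp w > 0` under `z ↦ z * exp z` in the strip
`|Im z| < π`. -/
lemma eq_of_mul_exp_eq_s8 {w : ℝ} (hw : 0 < w) {z : ℂ} (hz : z ∈ openStrip)
    (h : z * Complex.exp z = w * Complex.exp w) : z = w := by
  obtain ⟨hz1, hz2⟩ := hz
  have hre := congrArg Complex.re h
  have him := congrArg Complex.im h
  rw [← Complex.ofReal_exp, ← Complex.ofReal_mul, Complex.ofReal_re, Complex.mul_re,
    Complex.exp_re, Complex.exp_im] at hre
  rw [← Complex.ofReal_exp, ← Complex.ofReal_mul, Complex.ofReal_im, Complex.mul_im,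
    Complex.exp_re, Complex.exp_im] at him
  have hE := Real.exp_pos z.re
  have key : z.im * Real.exp z.re = -(w * Real.exp w * Real.sin z.im) := by
    have := Real.sin_sq_add_cos_sq z.im
    linear_combination (Real.cos z.im) * him - (Real.sin z.im) * hre
      - z.im * Real.exp z.re * this
  have hr : 0 < w * Real.exp w := mul_pos hw (Real.exp_pos w)
  have him0 : z.im = 0 := by
    rcases lt_trichotomy z.im 0 with h0 | h0 | h0
    · have hs := Real.sin_neg_of_neg_of_neg_pi_lt h0 hz1
      nlinarith [mul_neg_of_neg_of_pos h0 hE, mul_neg_of_pos_of_neg hr hs]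
    · exact h0
    · have hs := Real.sin_pos_of_pos_of_lt_pi h0 hz2
      nlinarith [mul_pos h0 hE, mul_pos hr hs]
  rw [him0] at hre
  simp only [Real.cos_zero, mul_one, zero_mul, sub_zero] at hre
  refine Complex.ext ?_ (by simpa using him0)
  rw [Complex.ofReal_re]
  rcases lt_trichotomy z.re w with h0 | h0 | h0
  · exact absurd hre (mul_exp_lt_mul_exp hw h0).ne
  · exact h0
  · exact absurd hre (mul_exp_lt_mul_exp (hw.trans h0) h0).ne'

/-- Subtracting its two simple poles from `z ↦ (1 + z) e^z / (z (z e^z - x))` leaves a function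
holomorphic on the strip `|Im z| < π`. -/
lemma exists_differentiableOn_sub_poles {x w : ℝ} (hw : 0 < w) (hx : w * Real.exp w = x) :
    ∃ h : ℂ → ℂ, DifferentiableOn ℂ h openStrip ∧ ∀ z ∈ openStrip, z ≠ 0 → z ≠ w →
      h z = (1 + z) * Complex.exp z / (z * (z * Complex.exp z - x))
        - 1 / w * (1 / (z - w)) + 1 / x * (1 / z) := by
  have hxc : (w : ℂ) * Complex.exp w = x := by rw [← hx]; push_cast; rfl
  have hx0 : 0 < x := hx ▸ mul_pos hw (Real.exp_pos w)
  have hx0c : (x : ℂ) ≠ 0 := by exact_mod_cast hx0.ne'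
  have hw0c : (w : ℂ) ≠ 0 := by exact_mod_cast hw.ne'
  have hwc1 : (1 + w : ℂ) ≠ 0 := by exact_mod_cast (by positivity : (1 + w : ℝ) ≠ 0)
  set q : ℂ → ℂ := fun z => z * Complex.exp z with hq
  set D := dslope q w with hD
  have hDw : D w = (1 + w) * Complex.exp w := by
    have : HasDerivAt q (1 * Complex.exp w + w * Complex.exp w) w :=
      (hasDerivAt_id (w : ℂ)).mul (Complex.hasDerivAt_exp w)
    rw [hD, dslope_same, this.deriv]; ring
  have hDz : ∀ z : ℂ, z ≠ w → D z = (z * Complex.exp z - x) / (z - w) := by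
    intro z hz
    rw [hD, dslope_of_ne _ hz, slope_def_field, hq]
    simp only [hxc]
  have hDdiff : DifferentiableOn ℂ D openStrip :=
    (Complex.differentiableOn_dslope (isOpen_openStrip.mem_nhds (ofReal_mem_openStrip w))).2
      (by fun_prop)
  have hD0 : ∀ z ∈ openStrip, D z ≠ 0 := by
    intro z hz
    by_cases hzw : z = w
    · rw [hzw, hDw]; exact mul_ne_zero hwc1 (Complex.exp_ne_zero _)
    · rw [hDz z hzw]
      refine div_ne_zero (fun h0 => hzw (eq_of_mul_exp_eq_s8 hw hz ?_)) (sub_ne_zero.2 hzw)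
      rw [hxc]; exact sub_eq_zero.1 h0
  set g : ℂ → ℂ := fun z => (1 + z) * Complex.exp z / D z with hg
  have hgdiff : DifferentiableOn ℂ g openStrip :=
    DifferentiableOn.div (by fun_prop) hDdiff hD0
  have hgw : g w = 1 := by
    simp only [hg, hDw]
    exact div_self (mul_ne_zero hwc1 (Complex.exp_ne_zero _))
  have hg0 : g 0 = w / x := by
    simp only [hg, hDz 0 hw0c.symm]
    simp only [zero_sub, add_zero, Complex.exp_zero, mul_one]
    field_simp
  have hds : ∀ a : ℝ, DifferentiableOn ℂ (dslope g a) openStrip := fun a =>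
    (Complex.differentiableOn_dslope (isOpen_openStrip.mem_nhds (ofReal_mem_openStrip a))).2 hgdiff
  refine ⟨fun z => 1 / w * (dslope g w z - dslope g (0 : ℝ) z),
    ((hds w).sub (hds 0)).const_mul _, fun z hz hz0 hzw => ?_⟩
  have hqz : z * Complex.exp z - x ≠ 0 := by
    intro h0
    exact hzw (eq_of_mul_exp_eq_s8 hw hz (by rw [hxc]; exact sub_eq_zero.1 h0))
  have hzw' : z - w ≠ 0 := sub_ne_zero.2 hzw
  simp only [Complex.ofReal_zero]
  rw [dslope_of_ne _ hzw, dslope_of_ne _ hz0, slope_def_field, slope_def_field, hgw, hg0]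
  simp only [hg, hDz z hzw, sub_zero]
  field_simp
  ring

lemma ofReal_im_eq_zero {x w : ℝ} {h : ℂ → ℂ} (hd : DifferentiableOn ℂ h openStrip)
    (hh : ∀ z ∈ openStrip, z ≠ 0 → z ≠ w →
      h z = (1 + z) * Complex.exp z / (z * (z * Complex.exp z - x))
        - 1 / w * (1 / (z - w)) + 1 / x * (1 / z)) (a : ℝ) : (h a).im = 0 := by
  have hcont : Continuous fun a : ℝ => (h a).im :=
    Complex.continuous_im.comp
      (hd.continuousOn.comp_continuous Complex.continuous_ofReal ofReal_mem_openStrip)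
  have hdense : Dense ({0, w} : Set ℝ)ᶜ := ((Set.toFinite {0, w}).countable).dense_compl ℝ
  refine congrFun (hcont.ext_on hdense continuous_const fun a ha => ?_) a
  simp only [mem_compl_iff, mem_insert_iff, mem_singleton_iff, not_or] at ha
  dsimp only
  rw [hh a (ofReal_mem_openStrip a) (by exact_mod_cast ha.1) (by exact_mod_cast ha.2)]
  have : (1 + (a : ℂ)) * Complex.exp a / (a * (a * Complex.exp a - x))
        - 1 / w * (1 / (a - w)) + 1 / x * (1 / a) =
      (((1 + a) * Real.exp a / (a * (a * Real.exp a - x))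
        - 1 / w * (1 / (a - w)) + 1 / x * (1 / a) : ℝ) : ℂ) := by push_cast; rfl
  rw [this, Complex.ofReal_im]

lemma im_primitive_ofReal {h H : ℂ → ℂ} (hH : ∀ z ∈ openStrip, HasDerivAt H (h z) z)
    (hreal : ∀ a : ℝ, (h a).im = 0) (a b : ℝ) : (H a).im = (H b).im := by
  have hder : ∀ a : ℝ, HasDerivAt (fun a : ℝ => (H a).im) 0 a := by
    intro a
    have h1 := (hH a (ofReal_mem_openStrip a)).comp_ofReal
    have h2 := Complex.imCLM.hasFDerivAt.comp_hasDerivAt a h1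
    simpa [hreal a, Function.comp_def] using h2
  exact is_const_of_deriv_eq_zero (fun a => (hder a).differentiableAt) (fun a => (hder a).deriv) a b

lemma norm_sub_poles_le {x w a : ℝ} (hw : 0 < w) (hx : 0 < x) (ha1 : 1 ≤ a) (haw : 2 * w ≤ a)
    (hax : 2 * x ≤ a) {z : ℂ} (hz : a ≤ z.re) :
    ‖(1 + z) * Complex.exp z / (z * (z * Complex.exp z - x))
        - 1 / w * (1 / (z - w)) + 1 / x * (1 / z)‖ ≤ (4 + 2 / w + 1 / x) / a := by
  have hza : a ≤ ‖z‖ := hz.trans (Complex.re_le_norm z)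
  have hz0 : 0 < ‖z‖ := by linarith
  have ha0 : 0 < a := by linarith
  have hE : 1 ≤ Real.exp z.re := Real.one_le_exp (by linarith)
  have h1 : ‖1 + z‖ ≤ 2 * ‖z‖ := by
    have := norm_add_le (1 : ℂ) z
    rw [norm_one] at this
    linarith
  have h2 : ‖z‖ * Real.exp z.re / 2 ≤ ‖z * Complex.exp z - x‖ := by
    have := norm_sub_norm_le (z * Complex.exp z) (x : ℂ)
    rw [norm_mul, Complex.norm_exp, Complex.norm_real, Real.norm_of_nonneg hx.le] at this
    nlinarith
  have h3 : a / 2 ≤ ‖z - w‖ := by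
    have := Complex.re_le_norm (z - w)
    rw [Complex.sub_re, Complex.ofReal_re] at this
    linarith
  have b1 : ‖(1 + z) * Complex.exp z / (z * (z * Complex.exp z - x))‖ ≤ 4 / a := by
    rw [norm_div, norm_mul, norm_mul, Complex.norm_exp]
    calc ‖1 + z‖ * Real.exp z.re / (‖z‖ * ‖z * Complex.exp z - x‖)
        ≤ 2 * ‖z‖ * Real.exp z.re / (‖z‖ * (‖z‖ * Real.exp z.re / 2)) := by gcongr
      _ = 4 / ‖z‖ := by field_simp; norm_num
      _ ≤ 4 / a := by gcongr
  have b2 : ‖(1 / w * (1 / (z - w)) : ℂ)‖ ≤ 2 / w / a := by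
    rw [norm_mul, norm_div, norm_div, norm_one, Complex.norm_real, Real.norm_of_nonneg hw.le]
    calc 1 / w * (1 / ‖z - w‖) ≤ 1 / w * (1 / (a / 2)) := by gcongr
      _ = 2 / w / a := by field_simp
  have b3 : ‖(1 / x * (1 / z) : ℂ)‖ ≤ 1 / x / a := by
    rw [norm_mul, norm_div, norm_div, norm_one, Complex.norm_real, Real.norm_of_nonneg hx.le]
    calc 1 / x * (1 / ‖z‖) ≤ 1 / x * (1 / a) := by gcongr
      _ = 1 / x / a := by field_simp
  calc _ ≤ 4 / a + 2 / w / a + 1 / x / a := norm_add_le_of_le (norm_sub_le_of_le b1 b2) b3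
    _ = _ := by ring

lemma tendsto_im_primitive {x w : ℝ} (hw : 0 < w) (hx : 0 < x) {h H : ℂ → ℂ}
    (hH : ∀ z ∈ openStrip, HasDerivAt H (h z) z)
    (hh : ∀ z ∈ openStrip, z ≠ 0 → z ≠ w →
      h z = (1 + z) * Complex.exp z / (z * (z * Complex.exp z - x))
        - 1 / w * (1 / (z - w)) + 1 / x * (1 / z))
    (hreal : ∀ a : ℝ, (h a).im = 0) {l : Filter ℝ} {γ : ℝ → ℂ}
    (hγ : ∀ᶠ v in l, γ v ∈ openStrip) (hre : Tendsto (fun v => (γ v).re) l atTop) :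
    Tendsto (fun v => (H (γ v)).im) l (𝓝 (H 0).im) := by
  rw [tendsto_iff_norm_sub_tendsto_zero]
  have hlim : Tendsto (fun v => (4 + 2 / w + 1 / x) / (γ v).re * π) l (𝓝 0) := by
    simpa using (hre.const_div_atTop (4 + 2 / w + 1 / x)).mul_const π
  refine squeeze_zero' (Eventually.of_forall fun _ => norm_nonneg _) ?_ hlim
  filter_upwards [hγ, hre.eventually_ge_atTop 1, hre.eventually_ge_atTop (2 * w),
    hre.eventually_ge_atTop (2 * x)] with v hv h1 h2 h3
  set a := (γ v).re with ha
  have hconv : Convex ℝ (openStrip ∩ {z | a ≤ z.re}) :=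
    convex_openStrip.inter (convex_halfSpace_re_ge a)
  have hbound := hconv.norm_image_sub_le_of_norm_hasDerivWithin_le (f := H) (f' := h)
    (C := (4 + 2 / w + 1 / x) / a) (x := (a : ℂ)) (y := γ v)
    (fun z hz => (hH z hz.1).hasDerivWithinAt)
    (fun z hz => by
      have hza : a ≤ z.re := hz.2
      rw [hh z hz.1 (fun h0 => by rw [h0, Complex.zero_re] at hza; linarith)
        (fun h0 => by rw [h0, Complex.ofReal_re] at hza; linarith)]
      exact norm_sub_poles_le hw hx h1 h2 h3 hza)
    ⟨ofReal_mem_openStrip a, by simp⟩ ⟨hv, le_refl a⟩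
  have hsub : γ v - a = (γ v).im * Complex.I := by
    apply Complex.ext <;> simp [ha]
  have him : ‖γ v - a‖ ≤ π := by
    rw [hsub, norm_mul, Complex.norm_I, mul_one, Complex.norm_real, Real.norm_eq_abs]
    exact abs_le.2 ⟨hv.1.le, hv.2.le⟩
  have h0 : (H 0).im = (H (a : ℂ)).im := by
    simpa using im_primitive_ofReal hH hreal 0 a
  rw [h0, ← Complex.sub_im, Real.norm_eq_abs]
  calc |(H (γ v) - H a).im| ≤ ‖H (γ v) - H a‖ := Complex.abs_im_le_norm _
    _ ≤ (4 + 2 / w + 1 / x) / a * ‖γ v - a‖ := hbound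
    _ ≤ (4 + 2 / w + 1 / x) / a * π := by gcongr

/-- The boundary value `-v cot v + i v` of the principal branch of Lambert W, seen from above its
cut, at the point `-(v / sin v) * exp (-v cot v)`. -/
noncomputable def lambertCurve (v : ℝ) : ℂ := -(v * Real.cot v : ℝ) + (v : ℝ) * Complex.I

@[simp] lemma lambertCurve_re (v : ℝ) : (lambertCurve v).re = -(v * Real.cot v) := by
  simp [lambertCurve, -Complex.ofReal_mul]

@[simp] lemma lambertCurve_im (v : ℝ) : (lambertCurve v).im = v := by
  simp [lambertCurve, -Complex.ofReal_mul]

lemma lambertCurve_mul_exp {v : ℝ} (hv : Real.sin v ≠ 0) :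
    lambertCurve v * Complex.exp (lambertCurve v) =
      (-(v / Real.sin v * Real.exp (-(v * Real.cot v))) : ℝ) := by
  have h := Real.sin_sq_add_cos_sq v
  apply Complex.ext
  · rw [Complex.mul_re, Complex.exp_re, Complex.exp_im, lambertCurve_re, lambertCurve_im,
      Complex.ofReal_re, Real.cot_eq_cos_div_sin]
    generalize Real.exp _ = E
    field_simp
    linear_combination (-v * E) * h
  · rw [Complex.mul_im, Complex.exp_re, Complex.exp_im, lambertCurve_re, lambertCurve_im,
      Complex.ofReal_im, Real.cot_eq_cos_div_sin]
    field_simp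
    ring

lemma hasDerivAt_lambertCurve {v : ℝ} (hv : Real.sin v ≠ 0) :
    HasDerivAt lambertCurve
      (-(Real.cot v - v / Real.sin v ^ 2 : ℝ) + Complex.I) v := by
  have h1 : HasDerivAt (fun v : ℝ => v * Real.cot v) (Real.cot v - v / Real.sin v ^ 2) v := by
    have h := (hasDerivAt_id v).mul ((Real.hasDerivAt_cos v).div (Real.hasDerivAt_sin v) hv)
    refine (h.congr_of_eventuallyEq (Eventually.of_forall fun u => ?_)).congr_deriv ?_
    · simp [Real.cot_eq_cos_div_sin]
    · have h2 := Real.sin_sq_add_cos_sq v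
      simp only [id, Pi.div_apply, Real.cot_eq_cos_div_sin]
      field_simp
      linear_combination -v * h2
  have h2 := h1.ofReal_comp.neg.add
    ((hasDerivAt_id v).ofReal_comp.mul_const Complex.I)
  exact h2.congr_deriv (by simp)

lemma im_mul_deriv_lambertCurve {x v : ℝ} (hx : 0 < x) (hv : v ∈ Ioo 0 π) :
    ((1 + lambertCurve v) * Complex.exp (lambertCurve v) /
        (lambertCurve v * (lambertCurve v * Complex.exp (lambertCurve v) - x)) *
        (-(Real.cot v - v / Real.sin v ^ 2 : ℝ) + Complex.I)).im =
      -((v ^ 2 + (1 - v * Real.cot v) ^ 2) /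
          (v * (1 / Real.sin v) *
            (v * (1 / Real.sin v) + x * Real.exp (v * Real.cot v)))) := by
  have hs := Real.sin_pos_of_pos_of_lt_pi hv.1 hv.2
  have hv0 : (v : ℝ) ≠ 0 := hv.1.ne'
  have hv0c : (v : ℂ) ≠ 0 := by exact_mod_cast hv0
  have hγ : lambertCurve v ≠ 0 := fun h => hv0 (by simpa using congrArg Complex.im h)
  set γ := lambertCurve v with hγdef
  have hsq : (v / Real.sin v) ^ 2 = (v * Real.cot v) ^ 2 + v ^ 2 := by
    have := Real.sin_sq_add_cos_sq v
    rw [Real.cot_eq_cos_div_sin]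
    field_simp
    linarith
  have hlog : v * ((1 + γ) * (-(Real.cot v - v / Real.sin v ^ 2 : ℝ) + Complex.I)) =
      γ * (v ^ 2 + (1 - v * Real.cot v) ^ 2 : ℝ) := by
    have hd : v * (v / Real.sin v ^ 2) = (v * Real.cot v) ^ 2 + v ^ 2 := by
      rw [← hsq]; ring
    have hdc : (v : ℂ) * (v / Real.sin v ^ 2 : ℝ) = (v * Real.cot v) ^ 2 + v ^ 2 := by
      exact_mod_cast hd
    rw [hγdef, lambertCurve]
    rw [Complex.ofReal_sub]
    push_cast at hdc ⊢
    linear_combination (1 - v * Complex.cot v + v * Complex.I) * hdc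
      + (v ^ 2 : ℂ) * Complex.I_sq
  set N := v ^ 2 + (1 - v * Real.cot v) ^ 2 with hN
  have hden : γ * Complex.exp γ - x =
      (-(v / Real.sin v * Real.exp (-(v * Real.cot v)) + x) : ℝ) := by
    rw [lambertCurve_mul_exp hs.ne']; push_cast; ring
  have hval : (1 + γ) * Complex.exp γ / (γ * (γ * Complex.exp γ - x)) *
        (-(Real.cot v - v / Real.sin v ^ 2 : ℝ) + Complex.I) =
      ((N / v * (v / Real.sin v * Real.exp (-(v * Real.cot v)) /
        (v / Real.sin v * Real.exp (-(v * Real.cot v)) + x)) : ℝ) : ℂ) * γ⁻¹ := by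
    have e : (1 + γ) * (-(Real.cot v - v / Real.sin v ^ 2 : ℝ) + Complex.I) = γ * N / v := by
      rw [eq_div_iff hv0c, ← hlog]; ring
    calc _ = ((1 + γ) * (-(Real.cot v - v / Real.sin v ^ 2 : ℝ) + Complex.I)) *
          (Complex.exp γ) / (γ * (γ * Complex.exp γ - x)) := by ring
      _ = (N / v) * ((γ * Complex.exp γ) / (γ * Complex.exp γ - x)) * γ⁻¹ := by
        rw [e]; field_simp
      _ = _ := by
        rw [hden, lambertCurve_mul_exp hs.ne', Complex.ofReal_neg, Complex.ofReal_neg,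
          neg_div_neg_eq]
        push_cast; rfl
  rw [hval, Complex.im_ofReal_mul, Complex.inv_im, hγdef, lambertCurve_im, Complex.normSq_apply,
    lambertCurve_re, lambertCurve_im]
  have hsq' : -(v * Real.cot v) * -(v * Real.cot v) + v * v = (v / Real.sin v) ^ 2 := by
    rw [hsq]; ring
  have hvpos := hv.1
  rw [hsq', Real.exp_neg]
  have hE := Real.exp_pos (v * Real.cot v)
  generalize Real.exp (v * Real.cot v) = E at *
  field_simp

lemma tendsto_lambertCurve_zero : Tendsto lambertCurve (𝓝[>] 0) (𝓝[{z | 0 ≤ z.im}] (-1)) := by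
  refine tendsto_nhdsWithin_iff.2 ⟨?_, ?_⟩
  · have h1 : Tendsto (fun v : ℝ => -((Real.cos v / Real.sinc v : ℝ) : ℂ) + v * Complex.I)
        (𝓝[>] 0) (𝓝 (-1)) := by
      have hc : ContinuousAt (fun v : ℝ => -((Real.cos v / Real.sinc v : ℝ) : ℂ) + v * Complex.I)
          0 := by
        have : ContinuousAt (fun v : ℝ => Real.cos v / Real.sinc v) 0 :=
          Real.continuous_cos.continuousAt.div Real.continuous_sinc.continuousAt (by simp)
        have := Complex.continuous_ofReal.continuousAt.comp this
        exact this.neg.add (by fun_prop)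
      simpa [ContinuousAt] using hc.tendsto.mono_left nhdsWithin_le_nhds
    refine h1.congr' ?_
    filter_upwards [self_mem_nhdsWithin] with v hv
    have hv0 : v ≠ 0 := (mem_Ioi.1 hv).ne'
    rw [lambertCurve, Real.sinc_of_ne_zero hv0, Real.cot_eq_cos_div_sin, div_div_eq_mul_div,
      mul_comm (Real.cos v), mul_div_assoc]
  · filter_upwards [self_mem_nhdsWithin] with v hv
    simpa using (mem_Ioi.1 hv).le

lemma tendsto_lambertCurve_re_pi :
    Tendsto (fun v => (lambertCurve v).re) (𝓝[<] π) atTop := by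
  have hsin : Tendsto Real.sin (𝓝[<] π) (𝓝[>] 0) := by
    refine tendsto_nhdsWithin_iff.2 ⟨?_, ?_⟩
    · simpa using (Real.continuous_sin.tendsto π).mono_left nhdsWithin_le_nhds
    · filter_upwards [Ioo_mem_nhdsLT Real.pi_pos] with v hv
      exact Real.sin_pos_of_pos_of_lt_pi hv.1 hv.2
  have hnum : Tendsto (fun v => -(v * Real.cos v)) (𝓝[<] π) (𝓝 π) := by
    have : Continuous fun v : ℝ => -(v * Real.cos v) := by fun_prop
    simpa using (this.tendsto π).mono_left nhdsWithin_le_nhds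
  refine (hnum.pos_mul_atTop Real.pi_pos hsin.inv_tendsto_nhdsGT_zero).congr fun v => ?_
  simp [Real.cot_eq_cos_div_sin, div_eq_mul_inv, mul_assoc]

lemma tendsto_arg_lambertCurve_sub_zero {c : ℝ} (hc : -1 < c) :
    Tendsto (fun v => (lambertCurve v - c).arg) (𝓝[>] 0) (𝓝 π) := by
  have h1 : Tendsto (fun v => lambertCurve v - c) (𝓝[>] 0) (𝓝[{z | 0 ≤ z.im}] (-1 - c)) := by
    obtain ⟨ha, hb⟩ := tendsto_nhdsWithin_iff.1 tendsto_lambertCurve_zero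
    refine tendsto_nhdsWithin_iff.2 ⟨ha.sub_const _, ?_⟩
    filter_upwards [hb] with v hv
    simpa using hv
  have h2 := Complex.continuousWithinAt_arg_of_re_neg_of_im_zero (z := (-1 - c : ℂ))
    (by simpa using (by linarith : -1 - c < 0)) (by simp)
  have h3 : Complex.arg (-1 - c) = π := by
    have : (-1 - c : ℂ) = (-1 - c : ℝ) := by push_cast; rfl
    rw [this, Complex.arg_ofReal_of_neg (by linarith)]
  rw [← h3]
  exact h2.tendsto.comp h1

lemma tendsto_arg_lambertCurve_sub_pi (c : ℝ) :
    Tendsto (fun v => (lambertCurve v - c).arg) (𝓝[<] π) (𝓝 0) := by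
  have hre : Tendsto (fun v => (lambertCurve v - c).re) (𝓝[<] π) atTop := by
    simpa [sub_eq_add_neg] using tendsto_atTop_add_const_right _ (-c) tendsto_lambertCurve_re_pi
  have him : Tendsto (fun v : ℝ => v) (𝓝[<] π) (𝓝 π) := nhdsWithin_le_nhds
  have hnorm : Tendsto (fun v => ‖lambertCurve v - c‖) (𝓝[<] π) atTop :=
    tendsto_atTop_mono (fun v => Complex.re_le_norm _) hre
  have h := (Real.continuous_arcsin.tendsto 0).comp (him.div_atTop hnorm)
  rw [Real.arcsin_zero] at h
  refine h.congr' ?_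
  filter_upwards [hre.eventually_ge_atTop 0] with v hv
  rw [Complex.arg_of_re_nonneg hv]
  simp

end

open Set Filter Topology MeasureTheory in
/-- The fundamental theorem of calculus for a nonnegative derivative on an open interval, in terms
of the one-sided limits at the endpoints; integrability is automatic. -/
lemma integral_eq_sub_of_hasDerivAt_of_tendsto_of_nonneg {f f' : ℝ → ℝ} {a b fa fb : ℝ}
    (hab : a < b) (hderiv : ∀ v ∈ Ioo a b, HasDerivAt f (f' v) v)
    (hpos : ∀ v ∈ Ioo a b, 0 ≤ f' v)
    (ha : Tendsto f (𝓝[>] a) (𝓝 fa)) (hb : Tendsto f (𝓝[<] b) (𝓝 fb)) :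
    ∫ v in a..b, f' v = fb - fa := by
  refine intervalIntegral.integral_eq_sub_of_hasDerivAt_of_tendsto hab hderiv ?_ ha hb
  have hcont : ContinuousOn (extendFrom (Ioo a b) f) (Icc a b) :=
    continuousOn_Icc_extendFrom_Ioo
      (fun v hv => (hderiv v hv).continuousAt.continuousWithinAt) ha hb
  refine (intervalIntegrable_iff_integrableOn_Ioc_of_le hab.le).2
    (intervalIntegral.integrableOn_deriv_of_nonneg hcont (fun v hv => ?_) hpos)
  refine (hderiv v hv).congr_of_eventuallyEq ?_
  filter_upwards [Ioo_mem_nhds hv.1 hv.2] with u hu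
  exact extendFrom_eq (subset_closure hu) ((hderiv u hu).continuousAt.tendsto.mono_left
    nhdsWithin_le_nhds)

open Set Filter Topology in
lemma integral_lambertCurve {x w : ℝ} (hw : 0 < w) (hwx : w * Real.exp w = x) :
    ∫ v in (0 : ℝ)..π, (v ^ 2 + (1 - v * Real.cot v) ^ 2) /
        (v * (1 / Real.sin v) * (v * (1 / Real.sin v) + x * Real.exp (v * Real.cot v))) =
      π * (1 / w - 1 / x) := by
  have hx : 0 < x := hwx ▸ mul_pos hw (Real.exp_pos w)
  obtain ⟨h, hd, hh⟩ := exists_differentiableOn_sub_poles hw hwx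
  obtain ⟨H, hH'⟩ := convex_openStrip.exists_forall_hasDerivWithinAt hd
  have hH : ∀ z ∈ openStrip, HasDerivAt H (h z) z := fun z hz =>
    (hH' z hz).hasDerivAt (isOpen_openStrip.mem_nhds hz)
  have hreal := ofReal_im_eq_zero hd hh
  have hmem : ∀ v ∈ Ioo 0 π, lambertCurve v ∈ openStrip := fun v hv => by
    simpa [openStrip] using And.intro (by linarith [hv.1, Real.pi_pos] : -π < v) hv.2
  have hH1 : Tendsto (fun v => (H (lambertCurve v)).im) (𝓝[>] 0) (𝓝 (H 0).im) := by
    have h1 : Tendsto lambertCurve (𝓝[>] 0) (𝓝 (-1 : ℝ)) := by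
      simpa using tendsto_lambertCurve_zero.mono_right nhdsWithin_le_nhds
    have h2 := (Complex.continuous_im.tendsto _).comp
      ((hH _ (ofReal_mem_openStrip (-1))).continuousAt.tendsto.comp h1)
    rw [im_primitive_ofReal hH hreal (-1) 0, Complex.ofReal_zero] at h2
    exact h2
  have hH2 := tendsto_im_primitive hw hx hH hh hreal
    (by filter_upwards [Ioo_mem_nhdsLT Real.pi_pos] with v hv using hmem v hv)
    tendsto_lambertCurve_re_pi
  have hG := integral_eq_sub_of_hasDerivAt_of_tendsto_of_nonneg Real.pi_pos
    (f := fun v => -((H (lambertCurve v)).im + 1 / w * (lambertCurve v - w).arg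
      - 1 / x * (lambertCurve v - (0 : ℝ)).arg))
    (f' := fun v => (v ^ 2 + (1 - v * Real.cot v) ^ 2) /
        (v * (1 / Real.sin v) * (v * (1 / Real.sin v) + x * Real.exp (v * Real.cot v))))
    (fun v hv => ?_) (fun v hv => ?_)
    ((hH1.add ((tendsto_arg_lambertCurve_sub_zero (by linarith)).const_mul _)).sub
      ((tendsto_arg_lambertCurve_sub_zero (by norm_num)).const_mul _)).neg
    ((hH2.add ((tendsto_arg_lambertCurve_sub_pi w).const_mul _)).sub
      ((tendsto_arg_lambertCurve_sub_pi 0).const_mul _)).neg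
  · rw [hG]; ring
  · have hs := Real.sin_pos_of_pos_of_lt_pi hv.1 hv.2
    have hγ := hasDerivAt_lambertCurve hs.ne'
    have hlog : ∀ c : ℝ, HasDerivAt (fun u => Complex.log (lambertCurve u - c))
        ((-(Real.cot v - v / Real.sin v ^ 2 : ℝ) + Complex.I) / (lambertCurve v - c)) v :=
      fun c => (hγ.sub_const (c : ℂ)).clog_real (Or.inr (by simpa using hv.1.ne'))
    have hne : ∀ c : ℝ, lambertCurve v ≠ c := fun c h0 =>
      hv.1.ne' (by simpa using congrArg Complex.im h0)
    have hF := (((hH _ (hmem v hv)).comp v hγ).add ((hlog w).const_mul (1 / w : ℂ))).sub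
      ((hlog 0).const_mul (1 / x : ℂ))
    have hF' := (Complex.imCLM.hasFDerivAt.comp_hasDerivAt v hF).neg
    refine (hF'.congr_of_eventuallyEq (Eventually.of_forall fun u => ?_)).congr_deriv ?_
    · have e : ∀ (r : ℝ) (z : ℂ), (1 / (r : ℂ) * Complex.log z).im = 1 / r * z.arg := by
        intro r z
        rw [← Complex.ofReal_one, ← Complex.ofReal_div, Complex.im_ofReal_mul, Complex.log_im]
      simp only [Function.comp_apply, Pi.neg_apply, Pi.add_apply, Pi.sub_apply,
        Complex.imCLM_apply, Complex.add_im, Complex.sub_im, e]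
    · rw [neg_eq_iff_eq_neg, ← im_mul_deriv_lambertCurve hx hv, Complex.imCLM_apply,
        hh _ (hmem v hv) (by simpa using hne 0) (hne w)]
      congr 1
      rw [Complex.ofReal_zero, sub_zero]
      ring
  · have hs := Real.sin_pos_of_pos_of_lt_pi hv.1 hv.2
    have := hv.1
    positivity

/-- Stieltjes integral representation of `1/W(x) - 1/x` for the principal real branch
of Lambert W on `(0, ∞)`. -/
theorem one_div_lambertW_sub (W : ℝ → ℝ)
    (hW : ∀ x > 0, W x * Real.exp (W x) = x) (hWpos : ∀ x > 0, W x > 0) :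
    ∀ x > (0:ℝ),
      1 / W x - 1 / x = (1 / π) * ∫ v in (0:ℝ)..π,
        (v ^ 2 + (1 - v * Real.cot v) ^ 2) /
          (v * (1 / Real.sin v) *
            (v * (1 / Real.sin v) + x * Real.exp (v * Real.cot v))) := by
  intro x hx
  rw [integral_lambertCurve (hWpos x hx) (hW x hx)]
  field_simp
end

section
/- Let W : ℝ → ℝ satisfy W(x) * exp(W(x)) = x and W(x) > 0 for all x > 0. Define φ(ξ) = (1/π) * ∫ from 0 to π of exp(-ξ * v * csc(v) * exp(-v * cot v)) dv for ξ > 0. Then for all x > 0, W(x) = ∫ from 0 to ∞ of (1 - exp(-x*ξ)) * φ(ξ) / ξ dξ. -/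
open Real MeasureTheory

open Set Filter Topology

namespace LambertW

/-- The kernel `v csc v exp (-v cot v)`. -/
noncomputable def kernel (v : ℝ) : ℝ :=
  v * (1 / Real.sin v) * Real.exp (-v * Real.cot v)

/-- The curve on which `z * exp z` is real and at most `-exp (-1)`. -/
noncomputable def cutCurve (v : ℝ) : ℂ := ⟨-v * Real.cot v, v⟩

/-- The open strip `|im z| < π`. -/
def strip : Set ℂ := Complex.im ⁻¹' Ioo (-π) π

lemma isOpen_strip : IsOpen strip := isOpen_Ioo.preimage Complex.continuous_im

lemma convex_strip : Convex ℝ strip :=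
  (convex_Ioo (-π) π).linear_preimage Complex.imLm

lemma ofReal_mem_strip (r : ℝ) : (r : ℂ) ∈ strip := by simp [strip, pi_pos]

lemma kernel_pos {v : ℝ} (hv : v ∈ Ioo 0 π) : 0 < kernel v := by
  have := sin_pos_of_mem_Ioo hv
  have := hv.1
  unfold kernel
  positivity

lemma measurable_kernel : Measurable kernel := by
  have : Measurable Real.cot := by
    have : Real.cot = fun x ↦ Real.cos x / Real.sin x := funext Real.cot_eq_cos_div_sin
    rw [this]; fun_prop
  unfold kernel
  fun_prop

lemma cutCurve_re (v : ℝ) : (cutCurve v).re = -v * Real.cot v := rfl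

@[simp] lemma cutCurve_im (v : ℝ) : (cutCurve v).im = v := rfl

lemma cutCurve_mul_exp {v : ℝ} (hv : v ∈ Ioo 0 π) :
    cutCurve v * Complex.exp (cutCurve v) = -(kernel v : ℂ) := by
  have hs := (sin_pos_of_mem_Ioo hv).ne'
  have h1 := Real.sin_sq_add_cos_sq v
  apply Complex.ext
  · rw [Complex.mul_re, Complex.exp_re, Complex.exp_im, cutCurve_re, cutCurve_im]
    simp only [kernel, Complex.neg_re, Complex.ofReal_re]
    set e := Real.exp (-v * Real.cot v)
    rw [Real.cot_eq_cos_div_sin]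
    field_simp
    linear_combination (-v * e) * h1
  · rw [Complex.mul_im, Complex.exp_re, Complex.exp_im, cutCurve_re, cutCurve_im]
    simp only [Complex.neg_im, Complex.ofReal_im]
    set e := Real.exp (-v * Real.cot v)
    rw [Real.cot_eq_cos_div_sin]
    field_simp
    ring

lemma strictMonoOn_mul_exp : StrictMonoOn (fun s : ℝ ↦ s * Real.exp s) (Ici 0) :=
  fun _ ha _ _ hab ↦ mul_lt_mul'' hab (Real.exp_lt_exp.2 hab) ha (Real.exp_pos _).le

lemma eq_ofReal_of_mul_exp_eq {w : ℝ} (hw : 0 < w) {z : ℂ} (hz : z ∈ strip)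
    (h : z * Complex.exp z = w * Complex.exp w) : z = w := by
  have hx : (w : ℂ) * Complex.exp w = ((w * Real.exp w : ℝ) : ℂ) := by push_cast; rfl
  rw [hx] at h
  have hre := congrArg Complex.re h
  have him := congrArg Complex.im h
  rw [Complex.mul_re, Complex.exp_re, Complex.exp_im, Complex.ofReal_re] at hre
  rw [Complex.mul_im, Complex.exp_re, Complex.exp_im, Complex.ofReal_im] at him
  have hP : 0 < w * Real.exp w := by positivity
  have he := Real.exp_pos z.re
  have key : (w * Real.exp w) * Real.sin z.im = -(Real.exp z.re * z.im) := by
    linear_combination (-Real.sin z.im) * hre + Real.cos z.im * him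
      - Real.exp z.re * z.im * Real.sin_sq_add_cos_sq z.im
  have h0 : z.im = 0 := by
    rcases lt_trichotomy z.im 0 with hb | hb | hb
    · have := Real.sin_neg_of_neg_of_neg_pi_lt hb hz.1
      nlinarith [mul_pos hP (neg_pos.2 this), mul_pos he (neg_pos.2 hb)]
    · exact hb
    · have := Real.sin_pos_of_pos_of_lt_pi hb hz.2
      nlinarith [mul_pos hP this, mul_pos he hb]
  simp only [h0, Real.cos_zero, Real.sin_zero, mul_zero, mul_one, sub_zero] at hre
  have hz0 : 0 < z.re := pos_of_mul_pos_left (hre ▸ hP) he.le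
  have : z.re = w := strictMonoOn_mul_exp.injOn hz0.le hw.le hre
  exact Complex.ext (by simpa using this) (by simpa using h0)

/-- The reciprocal of `w * exp w - z * exp z`, normalised to have residue `-1` at its unique pole
`w` in the strip, becomes holomorphic once the pole is removed. -/
lemma exists_differentiableOn_eq_add {w : ℝ} (hw : 0 < w) :
    ∃ h : ℂ → ℂ, DifferentiableOn ℂ h strip ∧ ∀ z ∈ strip, z ≠ w →
      h z = (1 + w) * Complex.exp w / (w * Complex.exp w - z * Complex.exp z) + 1 / (z - w) := by
  set f : ℂ → ℂ := fun z ↦ z * Complex.exp z with hf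
  set q := dslope f w
  have hnhds : strip ∈ 𝓝 (w : ℂ) := isOpen_strip.mem_nhds (ofReal_mem_strip w)
  have hfd : DifferentiableOn ℂ f strip := by fun_prop
  have hqd : DifferentiableOn ℂ q strip := (Complex.differentiableOn_dslope hnhds).2 hfd
  have hqw : q w = (1 + w) * Complex.exp w := by
    have : HasDerivAt f (1 * Complex.exp w + w * Complex.exp w) w :=
      (hasDerivAt_id _).mul (Complex.hasDerivAt_exp _)
    rw [show q w = deriv f w from dslope_same f _, this.deriv]
    ring
  have hqz : ∀ z ≠ (w : ℂ), q z = (f z - f w) / (z - w) := fun z hz ↦ by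
    rw [show q z = slope f w z from dslope_of_ne f hz, slope_def_field]
  have hq0 : ∀ z ∈ strip, q z ≠ 0 := fun z hz ↦ by
    by_cases hzw : z = w
    · rw [hzw, hqw]
      refine mul_ne_zero ?_ (Complex.exp_ne_zero _)
      exact_mod_cast (by positivity : 1 + w ≠ 0)
    · rw [hqz z hzw]
      refine div_ne_zero (sub_ne_zero.2 fun h ↦ hzw ?_) (sub_ne_zero.2 hzw)
      exact eq_ofReal_of_mul_exp_eq hw hz h
  refine ⟨fun z ↦ dslope q w z / q z,
    ((Complex.differentiableOn_dslope hnhds).2 hqd).div hqd hq0, fun z hz hzw ↦ ?_⟩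
  have h1 : z - w ≠ 0 := sub_ne_zero.2 hzw
  have h2 : f z - f w ≠ 0 := fun h ↦ hq0 z hz (by rw [hqz z hzw, h, zero_div])
  have h3 : (w * Complex.exp w - z * Complex.exp z) ≠ 0 := fun h ↦ h2 (by
    simp only [hf]; linear_combination -h)
  have h4 : f z - f w = -(w * Complex.exp w - z * Complex.exp z) := by simp only [hf]; ring
  simp only
  rw [dslope_of_ne q hzw, slope_def_field, hqw, hqz z hzw, h4]
  field_simp
  ring

lemma exists_primitive {w : ℝ} (hw : 0 < w) :
    ∃ (h H : ℂ → ℂ) (k : ℝ), (∀ z ∈ strip, HasDerivAt H (h z) z) ∧ (∀ r : ℝ, (H r).im = k) ∧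
      ∀ z ∈ strip, z ≠ w →
      h z = (1 + w) * Complex.exp w / (w * Complex.exp w - z * Complex.exp z) + 1 / (z - w) := by
  obtain ⟨h, hd, hh⟩ := exists_differentiableOn_eq_add hw
  obtain ⟨H, hH⟩ := convex_strip.exists_forall_hasDerivWithinAt hd
  have hH' : ∀ z ∈ strip, HasDerivAt H (h z) z :=
    fun z hz ↦ (hH z hz).hasDerivAt (isOpen_strip.mem_nhds hz)
  have hcont : Continuous fun r : ℝ ↦ (h r).im :=
    Complex.continuous_im.comp (hd.continuousOn.comp_continuous Complex.continuous_ofReal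
      ofReal_mem_strip)
  have hreal : (fun r : ℝ ↦ (h r).im) = fun _ ↦ 0 := by
    refine hcont.ext_on (dense_compl_singleton w) continuous_const fun r hr ↦ ?_
    beta_reduce
    rw [hh r (ofReal_mem_strip r) (by exact_mod_cast hr)]
    norm_cast
  have hder : ∀ r : ℝ, HasDerivAt (fun r : ℝ ↦ (H r).im) 0 r := fun r ↦ by
    have := (hH' r (ofReal_mem_strip r)).comp_ofReal
    have := (Complex.imCLM.hasFDerivAt (x := H r)).comp_hasDerivAt r this
    simpa [Function.comp_def, congrFun hreal r] using this
  refine ⟨h, H, (H 0).im, hH', fun r ↦ ?_, hh⟩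
  simpa using is_const_of_deriv_eq_zero (fun r ↦ (hder r).differentiableAt)
    (fun r ↦ (hder r).deriv) r 0

lemma tendsto_cutCurve_re_nhdsLT_pi :
    Tendsto (fun v ↦ (cutCurve v).re) (𝓝[<] π) atTop := by
  have h1 : Tendsto Real.sin (𝓝[<] π) (𝓝[>] 0) := by
    refine tendsto_nhdsWithin_iff.2 ⟨?_, ?_⟩
    · simpa using (Real.continuous_sin.tendsto π).mono_left nhdsWithin_le_nhds
    · filter_upwards [Ioo_mem_nhdsLT pi_pos] with v hv using sin_pos_of_mem_Ioo hv
  have h2 : Tendsto (fun v ↦ -v * Real.cos v) (𝓝[<] π) (𝓝 π) := by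
    have : Continuous fun v ↦ -v * Real.cos v := by fun_prop
    simpa using (this.tendsto π).mono_left nhdsWithin_le_nhds
  refine (h2.pos_mul_atTop pi_pos h1.inv_tendsto_nhdsGT_zero).congr fun v ↦ ?_
  rw [cutCurve_re, Real.cot_eq_cos_div_sin, Pi.inv_apply]
  ring

lemma tendsto_cutCurve_nhdsGT_zero : Tendsto cutCurve (𝓝[>] 0) (𝓝 ((-1 : ℝ) : ℂ)) := by
  have h1 : ContinuousAt (fun v ↦ ((-(Real.cos v / Real.sinc v) : ℝ) : ℂ) + v * Complex.I) 0 := by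
    have := Real.continuous_sinc.continuousAt (x := 0)
    have h0 : Real.sinc 0 ≠ 0 := by simp
    fun_prop (disch := assumption)
  have h2 := h1.tendsto.mono_left (nhdsWithin_le_nhds (s := Ioi 0))
  simp only [Real.cos_zero, Real.sinc_zero, div_one, Complex.ofReal_zero, zero_mul, add_zero] at h2
  refine h2.congr' ?_
  filter_upwards [self_mem_nhdsWithin] with v hv
  have hv : v ≠ 0 := (mem_Ioi.1 hv).ne'
  rw [cutCurve, Complex.mk_eq_add_mul_I, Real.sinc_of_ne_zero hv, Real.cot_eq_cos_div_sin]
  congr 2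
  rw [div_div_eq_mul_div]
  ring

lemma hasDerivAt_cutCurve {v : ℝ} (hv : v ∈ Ioo 0 π) :
    ∃ d : ℝ, HasDerivAt cutCurve (d + Complex.I) v := by
  have hs := (sin_pos_of_mem_Ioo hv).ne'
  have h1 : DifferentiableAt ℝ (fun v ↦ -v * Real.cot v) v := by
    simp only [Real.cot_eq_cos_div_sin]
    fun_prop (disch := assumption)
  have h2 : cutCurve = fun v ↦ ((-v * Real.cot v : ℝ) : ℂ) + v * Complex.I :=
    funext fun v ↦ Complex.mk_eq_add_mul_I _ _
  rw [h2]
  refine ⟨_, h1.hasDerivAt.ofReal_comp.add (g := fun v : ℝ ↦ (v : ℂ) * Complex.I) ?_⟩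
  simpa using (hasDerivAt_id v).ofReal_comp.mul_const Complex.I

lemma tendsto_arg_sub_cutCurve (w : ℝ) :
    Tendsto (fun v ↦ Complex.arg (w - cutCurve v)) (𝓝[<] π) (𝓝 (-π)) := by
  have hinf : Tendsto (fun v ↦ (cutCurve v).re - w) (𝓝[<] π) atTop :=
    tendsto_atTop_add_const_right _ _ tendsto_cutCurve_re_nhdsLT_pi
  have h1 : Tendsto (fun v ↦ v * ((cutCurve v).re - w)⁻¹) (𝓝[<] π) (𝓝 (π * 0)) :=
    (tendsto_id.mono_left nhdsWithin_le_nhds).mul hinf.inv_tendsto_atTop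
  have h2 : Tendsto (fun v : ℝ ↦ (1 : ℂ) + ((v * ((cutCurve v).re - w)⁻¹ : ℝ) : ℂ) * Complex.I)
      (𝓝[<] π) (𝓝 1) := by
    have := (((Complex.continuous_ofReal.tendsto _).comp h1).mul_const Complex.I).const_add 1
    simpa [Function.comp_def] using this
  have h3 := ((Complex.continuousAt_arg Complex.one_mem_slitPlane).tendsto.comp h2).sub_const π
  simp only [Complex.arg_one, zero_sub] at h3
  refine h3.congr' ?_
  filter_upwards [Ioo_mem_nhdsLT pi_pos, hinf.eventually_gt_atTop 0] with v hv hpos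
  have him : 0 < (cutCurve v - w).im := by simpa using hv.1
  rw [← neg_sub (cutCurve v), Complex.arg_neg_eq_arg_sub_pi_of_im_pos him, Function.comp_apply,
    ← Complex.arg_real_mul _ hpos]
  congr 2
  have hne := hpos.ne'
  rw [mul_add, mul_one, ← mul_assoc, ← Complex.ofReal_mul, mul_left_comm, mul_inv_cancel₀ hne,
    mul_one]
  apply Complex.ext <;> simp

lemma tendsto_im_primitive {w k : ℝ} {h H : ℂ → ℂ} (hH : ∀ z ∈ strip, HasDerivAt H (h z) z)
    (hk : ∀ r : ℝ, (H r).im = k)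
    (hh : ∀ z ∈ strip, z ≠ w →
      h z = (1 + w) * Complex.exp w / (w * Complex.exp w - z * Complex.exp z) + 1 / (z - w)) :
    Tendsto (fun v ↦ (H (cutCurve v)).im) (𝓝[<] π) (𝓝 k) := by
  set B : ℝ → ℝ := fun R ↦
    ‖(1 + w) * Complex.exp w‖ * (R * Real.exp R - ‖w * Complex.exp w‖)⁻¹ + (R - ‖(w : ℂ)‖)⁻¹
    with hBdef
  have hgrow : Tendsto (fun R : ℝ ↦ R * Real.exp R - ‖w * Complex.exp w‖) atTop atTop :=
    tendsto_atTop_add_const_right _ _ (tendsto_id.atTop_mul_atTop₀ Real.tendsto_exp_atTop)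
  have hgrow' : Tendsto (fun R : ℝ ↦ R - ‖(w : ℂ)‖) atTop atTop :=
    tendsto_atTop_add_const_right _ _ tendsto_id
  have hB : Tendsto B atTop (𝓝 0) := by
    have := (hgrow.inv_tendsto_atTop.const_mul ‖(1 + w) * Complex.exp w‖).add
      hgrow'.inv_tendsto_atTop
    rwa [mul_zero, zero_add] at this
  have hbound : ∀ᶠ R in atTop, ∀ z ∈ strip ∩ Complex.re ⁻¹' Ici R, ‖h z‖ ≤ B R := by
    filter_upwards [eventually_ge_atTop 0, hgrow.eventually_gt_atTop 0,
      hgrow'.eventually_gt_atTop 0] with R hR h1 h2 z hz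
    have hre : R ≤ z.re := hz.2
    have hzR : R ≤ ‖z‖ := hre.trans (Complex.re_le_norm z)
    have h3 : R - ‖(w : ℂ)‖ ≤ ‖z - w‖ := by linarith [norm_sub_norm_le z w]
    have h4 : R * Real.exp R - ‖w * Complex.exp w‖ ≤ ‖w * Complex.exp w - z * Complex.exp z‖ := by
      have : R * Real.exp R ≤ ‖z * Complex.exp z‖ := by
        rw [norm_mul, Complex.norm_exp]
        gcongr
      linarith [norm_sub_norm_le (z * Complex.exp z) (w * Complex.exp w),
        norm_sub_rev (z * Complex.exp z) (w * Complex.exp w)]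
    have hzw : z ≠ w := fun e ↦ by
      rw [e, sub_self, norm_zero] at h3; linarith
    rw [hh z hz.1 hzw]
    refine (norm_add_le _ _).trans ?_
    rw [norm_div, norm_div, norm_one, one_div, div_eq_mul_inv]
    simp only [hBdef]
    gcongr
  have hre := tendsto_cutCurve_re_nhdsLT_pi
  have hlim : Tendsto (fun v ↦ B (cutCurve v).re * π) (𝓝[<] π) (𝓝 0) := by
    simpa [Function.comp_def] using (hB.comp hre).mul_const π
  rw [← tendsto_sub_nhds_zero_iff]
  refine squeeze_zero_norm' ?_ hlim
  filter_upwards [Ioo_mem_nhdsLT pi_pos, hre.eventually hbound] with v hv hb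
  set R := (cutCurve v).re
  set s := strip ∩ Complex.re ⁻¹' Ici R
  have hs : Convex ℝ s := convex_strip.inter ((convex_Ici R).linear_preimage Complex.reLm)
  have hxs : (R : ℂ) ∈ s := ⟨ofReal_mem_strip R, by simp⟩
  have hys : cutCurve v ∈ s :=
    ⟨⟨by simpa using (neg_neg_of_pos pi_pos).trans hv.1, by simpa using hv.2⟩, le_refl R⟩
  have hmv := hs.norm_image_sub_le_of_norm_hasDerivWithin_le
    (fun z hz ↦ (hH z hz.1).hasDerivWithinAt) hb hxs hys
  have hB0 : 0 ≤ B R := (norm_nonneg _).trans (hb _ hxs)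
  have hdist : ‖cutCurve v - R‖ ≤ π := by
    have : cutCurve v - R = v * Complex.I := by apply Complex.ext <;> simp [R]
    rw [this, norm_mul, Complex.norm_I, mul_one, Complex.norm_real, Real.norm_of_nonneg hv.1.le]
    exact hv.2.le
  rw [← hk R, ← Complex.sub_im, Real.norm_eq_abs]
  exact (Complex.abs_im_le_norm _).trans (hmv.trans (by gcongr))

lemma kernel_nonneg {v : ℝ} (hv : v ∈ Icc 0 π) : 0 ≤ kernel v := by
  have := sin_nonneg_of_mem_Icc hv
  have := hv.1
  unfold kernel
  positivity

lemma intervalIntegrable_div_kernel (c : ℝ) {x : ℝ} (hx : 0 < x) :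
    IntervalIntegrable (fun v ↦ c / (x + kernel v)) volume 0 π := by
  rw [intervalIntegrable_iff_integrableOn_Ioc_of_le pi_pos.le]
  refine Measure.integrableOn_of_bounded (M := |c| / x) measure_Ioc_lt_top.ne
    (measurable_const.div (measurable_const.add measurable_kernel)).aestronglyMeasurable ?_
  filter_upwards [ae_restrict_mem measurableSet_Ioc] with v hv
  have := kernel_nonneg (Ioc_subset_Icc_self hv)
  rw [norm_div, Real.norm_eq_abs, Real.norm_of_nonneg (by positivity)]
  gcongr
  linarith

lemma integral_div_kernel {w : ℝ} (hw : 0 < w) :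
    ∫ v in (0 : ℝ)..π, (1 + w) * Real.exp w / (w * Real.exp w + kernel v) = π := by
  obtain ⟨h, H, k, hH, hk, hh⟩ := exists_primitive hw
  have hder : ∀ v ∈ Ioo 0 π,
      HasDerivAt (fun v ↦ (H (cutCurve v)).im - Complex.arg (w - cutCurve v))
        ((1 + w) * Real.exp w / (w * Real.exp w + kernel v)) v := by
    intro v hv
    obtain ⟨d, hd⟩ := hasDerivAt_cutCurve hv
    have hmem : cutCurve v ∈ strip :=
      ⟨by simpa using (neg_neg_of_pos pi_pos).trans hv.1, by simpa using hv.2⟩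
    have hslit : (w : ℂ) - cutCurve v ∈ Complex.slitPlane :=
      Or.inr (by simpa using hv.1.ne')
    have hne : cutCurve v ≠ w := fun e ↦ Complex.slitPlane_ne_zero hslit (by rw [e, sub_self])
    have h1 := ((hH _ hmem).comp v hd).sub ((hd.const_sub (w : ℂ)).clog_real hslit)
    have h2 := (Complex.imCLM.hasFDerivAt).comp_hasDerivAt v h1
    have h3 : h (cutCurve v) * (d + Complex.I) - -(d + Complex.I) / (w - cutCurve v) =
        (((1 + w) * Real.exp w / (w * Real.exp w + kernel v) : ℝ) : ℂ) * (d + Complex.I) := by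
      have h4 : cutCurve v - w ≠ 0 := sub_ne_zero.2 hne
      have h5 : (w : ℂ) - cutCurve v ≠ 0 := sub_ne_zero.2 hne.symm
      rw [hh _ hmem hne, cutCurve_mul_exp hv, ← neg_sub (cutCurve v) (w : ℂ), neg_div_neg_eq]
      push_cast
      ring
    rw [h3, Complex.imCLM_apply, Complex.im_ofReal_mul] at h2
    simpa [Function.comp_def, Complex.log_im] using h2
  have hzero : Tendsto (fun v ↦ (H (cutCurve v)).im - Complex.arg (w - cutCurve v))
      (𝓝[>] 0) (𝓝 (k - 0)) := by
    refine Tendsto.sub ?_ ?_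
    · rw [← hk (-1)]
      exact (Complex.continuous_im.tendsto _).comp
        ((hH _ (ofReal_mem_strip _)).continuousAt.tendsto.comp tendsto_cutCurve_nhdsGT_zero)
    · have h1 : (w : ℂ) - ((-1 : ℝ) : ℂ) = ((w + 1 : ℝ) : ℂ) := by push_cast; ring
      have h2 : (w : ℂ) - ((-1 : ℝ) : ℂ) ∈ Complex.slitPlane := by
        rw [h1, Complex.ofReal_mem_slitPlane]; positivity
      have h3 := (Complex.continuousAt_arg h2).tendsto.comp
        (tendsto_cutCurve_nhdsGT_zero.const_sub (w : ℂ))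
      rwa [h1, Complex.arg_ofReal_of_nonneg (by positivity)] at h3
  rw [intervalIntegral.integral_eq_sub_of_hasDerivAt_of_tendsto pi_pos hder
    (intervalIntegrable_div_kernel _ (by positivity)) hzero
    ((tendsto_im_primitive hH hk hh).sub (tendsto_arg_sub_cutCurve w))]
  ring

lemma lintegral_ofReal_inv_kernel {w : ℝ} (hw : 0 < w) :
    ENNReal.ofReal ((1 + w) * Real.exp w) *
      ∫⁻ v in Ioo 0 π, ENNReal.ofReal (1 / π * (1 / (kernel v + w * Real.exp w))) = 1 := by
  have hx : 0 < w * Real.exp w := by positivity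
  rw [← lintegral_const_mul' _ _ ENNReal.ofReal_ne_top]
  have h1 : ∀ v, ENNReal.ofReal ((1 + w) * Real.exp w) *
      ENNReal.ofReal (1 / π * (1 / (kernel v + w * Real.exp w))) =
      ENNReal.ofReal (1 / π * ((1 + w) * Real.exp w / (w * Real.exp w + kernel v))) := fun v ↦ by
    rw [← ENNReal.ofReal_mul (by positivity)]
    congr 1
    ring
  simp_rw [h1]
  have hint := (intervalIntegrable_iff_integrableOn_Ioo_of_le pi_pos.le).1
    (intervalIntegrable_div_kernel ((1 + w) * Real.exp w) hx)
  rw [← ofReal_integral_eq_lintegral_ofReal (hint.const_mul _), integral_const_mul,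
    ← integral_Ioc_eq_integral_Ioo, ← intervalIntegral.integral_of_le pi_pos.le,
    integral_div_kernel hw, one_div_mul_cancel pi_ne_zero, ENNReal.ofReal_one]
  filter_upwards [ae_restrict_mem measurableSet_Ioo] with v hv
  have := kernel_pos hv
  have : 0 < π := pi_pos
  simp only [Pi.zero_apply]
  positivity

lemma image_mul_exp_Ioo {w : ℝ} (hw : 0 ≤ w) :
    (fun s : ℝ ↦ s * Real.exp s) '' Ioo 0 w = Ioo 0 (w * Real.exp w) := by
  refine Subset.antisymm ?_ ?_
  · rintro _ ⟨s, hs, rfl⟩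
    exact ⟨mul_pos hs.1 (Real.exp_pos s), strictMonoOn_mul_exp hs.1.le hw hs.2⟩
  · have : ContinuousOn (fun s : ℝ ↦ s * Real.exp s) (Icc 0 w) := by fun_prop
    simpa using intermediate_value_Ioo hw this

lemma lintegral_Ioo_mul_exp {w : ℝ} (hw : 0 < w) :
    ∫⁻ t in Ioo 0 (w * Real.exp w), ∫⁻ v in Ioo 0 π,
      ENNReal.ofReal (1 / π * (1 / (kernel v + t))) = ENNReal.ofReal w := by
  have hder : ∀ s ∈ Ioo 0 w, HasDerivWithinAt (fun s : ℝ ↦ s * Real.exp s)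
      ((1 + s) * Real.exp s) (Ioo 0 w) s := fun s _ ↦ by
    refine (((hasDerivAt_id s).mul (Real.hasDerivAt_exp s)).congr_deriv ?_).hasDerivWithinAt
    simp only [id]
    ring
  rw [← image_mul_exp_Ioo hw.le, lintegral_image_eq_lintegral_abs_deriv_mul measurableSet_Ioo hder
    (strictMonoOn_mul_exp.injOn.mono fun s hs ↦ hs.1.le)]
  have h1 : ∀ s ∈ Ioo 0 w, ENNReal.ofReal |(1 + s) * Real.exp s| *
      ∫⁻ v in Ioo 0 π, ENNReal.ofReal (1 / π * (1 / (kernel v + s * Real.exp s))) = 1 :=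
    fun s hs ↦ by
      have := hs.1
      rw [abs_of_pos (by positivity), lintegral_ofReal_inv_kernel hs.1]
  rw [setLIntegral_congr_fun measurableSet_Ioo h1]
  simp

lemma lintegral_exp_neg_mul_Ioi {a : ℝ} (ha : 0 < a) :
    ∫⁻ ξ in Ioi (0 : ℝ), ENNReal.ofReal (Real.exp (-ξ * a)) = ENNReal.ofReal (1 / a) := by
  have hint : IntegrableOn (fun ξ : ℝ ↦ Real.exp (-a * ξ)) (Ioi 0) :=
    integrableOn_exp_mul_Ioi (by linarith) 0
  have : ∀ ξ : ℝ, -ξ * a = -a * ξ := fun ξ ↦ by ring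
  simp_rw [this]
  rw [← ofReal_integral_eq_lintegral_ofReal hint (ae_of_all _ fun _ ↦ (Real.exp_pos _).le),
    integral_exp_mul_Ioi (by linarith)]
  simp

lemma lintegral_exp_eq_ofReal {ξ x : ℝ} (hξ : 0 < ξ) (hx : 0 < x) :
    ∫⁻ t in Ioo 0 x, ∫⁻ v in Ioo 0 π, ENNReal.ofReal (1 / π * Real.exp (-ξ * (kernel v + t))) =
      ENNReal.ofReal ((1 - Real.exp (-x * ξ)) *
        ((1 / π) * ∫ v in (0 : ℝ)..π, Real.exp (-ξ * kernel v)) / ξ) := by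
  set I := ∫ v in (0 : ℝ)..π, Real.exp (-ξ * kernel v) with hI
  have hI0 : 0 ≤ I := intervalIntegral.integral_nonneg pi_pos.le fun _ _ ↦ (Real.exp_pos _).le
  have hint : IntegrableOn (fun v ↦ Real.exp (-ξ * kernel v)) (Ioo 0 π) := by
    refine Measure.integrableOn_of_bounded (M := 1) measure_Ioo_lt_top.ne
      (measurable_kernel.const_mul _).exp.aestronglyMeasurable ?_
    filter_upwards [ae_restrict_mem measurableSet_Ioo] with v hv
    rw [Real.norm_of_nonneg (Real.exp_pos _).le, Real.exp_le_one_iff]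
    nlinarith [kernel_pos hv]
  have h1 : ∀ t : ℝ, ∫⁻ v in Ioo 0 π, ENNReal.ofReal (1 / π * Real.exp (-ξ * (kernel v + t))) =
      ENNReal.ofReal (Real.exp (-ξ * t) * (1 / π * I)) := fun t ↦ by
    rw [hI, intervalIntegral.integral_of_le pi_pos.le, integral_Ioc_eq_integral_Ioo,
      ← integral_const_mul, ← integral_const_mul,
      ofReal_integral_eq_lintegral_ofReal ((hint.const_mul _).const_mul _)
      (ae_of_all _ fun _ ↦ by have := pi_pos; simp only [Pi.zero_apply]; positivity)]
    refine lintegral_congr fun v ↦ ?_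
    rw [mul_add, Real.exp_add]
    congr 1
    ring
  simp_rw [h1]
  have hint' : IntegrableOn (fun t : ℝ ↦ Real.exp (-ξ * t)) (Ioo 0 x) :=
    (by fun_prop : Continuous fun t : ℝ ↦ Real.exp (-ξ * t)).integrableOn_Icc.mono_set
      Ioo_subset_Icc_self
  rw [← ofReal_integral_eq_lintegral_ofReal (hint'.mul_const _)
    (ae_of_all _ fun _ ↦ by have := pi_pos; simp only [Pi.zero_apply]; positivity),
    integral_mul_const, ← integral_Ioc_eq_integral_Ioo, ← intervalIntegral.integral_of_le hx.le,
    intervalIntegral.integral_comp_mul_left (fun t ↦ Real.exp t) (neg_ne_zero.2 hξ.ne'),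
    integral_exp]
  congr 1
  rw [mul_zero, Real.exp_zero, smul_eq_mul, show -ξ * x = -x * ξ by ring]
  field_simp
  ring

lemma lintegral_Ioi_exp {w : ℝ} (hw : 0 < w) :
    ∫⁻ ξ in Ioi (0 : ℝ), ∫⁻ t in Ioo 0 (w * Real.exp w), ∫⁻ v in Ioo 0 π,
      ENNReal.ofReal (1 / π * Real.exp (-ξ * (kernel v + t))) = ENNReal.ofReal w := by
  have hk := measurable_kernel
  have hm : Measurable fun p : (ℝ × ℝ) × ℝ ↦
      ENNReal.ofReal (1 / π * Real.exp (-p.1.1 * (kernel p.2 + p.1.2))) := by fun_prop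
  rw [lintegral_lintegral_swap hm.lintegral_prod_right'.aemeasurable, ← lintegral_Ioo_mul_exp hw]
  refine setLIntegral_congr_fun measurableSet_Ioo fun t ht ↦ ?_
  have hm' : Measurable fun p : ℝ × ℝ ↦
      ENNReal.ofReal (1 / π * Real.exp (-p.1 * (kernel p.2 + t))) := by fun_prop
  rw [lintegral_lintegral_swap hm'.aemeasurable]
  refine setLIntegral_congr_fun measurableSet_Ioo fun v hv ↦ ?_
  have hpi : 0 ≤ 1 / π := by have := pi_pos; positivity
  simp_rw [ENNReal.ofReal_mul hpi]
  rw [lintegral_const_mul' _ _ ENNReal.ofReal_ne_top,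
    lintegral_exp_neg_mul_Ioi (add_pos (kernel_pos hv) ht.1)]

end LambertW

/-- Lévy–Khintchine (Bernstein) representation of Lambert W on `(0, ∞)`. -/
theorem lambertW_levy_khintchine (W : ℝ → ℝ)
    (hW : ∀ x > 0, W x * Real.exp (W x) = x) (hWpos : ∀ x > 0, W x > 0)
    (φ : ℝ → ℝ)
    (hφ : ∀ ξ > (0:ℝ), φ ξ = (1 / π) * ∫ v in (0:ℝ)..π,
        Real.exp (-ξ * (v * (1 / Real.sin v) * Real.exp (-v * Real.cot v)))) :
    ∀ x > (0:ℝ),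
      W x = ∫ ξ in Set.Ioi (0:ℝ), (1 - Real.exp (-x * ξ)) * φ ξ / ξ := by
  intro x hx
  have hw := hWpos x hx
  have hk := LambertW.measurable_kernel
  set G : ℝ → ENNReal := fun ξ ↦ ∫⁻ t in Ioo 0 x, ∫⁻ v in Ioo 0 π,
    ENNReal.ofReal (1 / π * Real.exp (-ξ * (LambertW.kernel v + t))) with hG
  have hGm : Measurable G := by
    have hm : Measurable fun p : (ℝ × ℝ) × ℝ ↦
        ENNReal.ofReal (1 / π * Real.exp (-p.1.1 * (LambertW.kernel p.2 + p.1.2))) := by fun_prop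
    exact hm.lintegral_prod_right'.lintegral_prod_right'
  have hGφ : ∀ ξ ∈ Ioi (0 : ℝ), G ξ = ENNReal.ofReal ((1 - Real.exp (-x * ξ)) * φ ξ / ξ) :=
    fun ξ hξ ↦ by
      rw [hφ ξ hξ]
      exact LambertW.lintegral_exp_eq_ofReal hξ hx
  have hφ0 : ∀ ξ ∈ Ioi (0 : ℝ), 0 ≤ (1 - Real.exp (-x * ξ)) * φ ξ / ξ := fun ξ hξ ↦ by
    have hξ : 0 < ξ := hξ
    have h1 : 0 ≤ φ ξ := by
      rw [hφ ξ hξ]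
      exact mul_nonneg (by have := pi_pos; positivity)
        (intervalIntegral.integral_nonneg pi_pos.le fun _ _ ↦ (Real.exp_pos _).le)
    have h2 : Real.exp (-x * ξ) ≤ 1 := Real.exp_le_one_iff.2 (by nlinarith)
    exact div_nonneg (mul_nonneg (sub_nonneg.2 h2) h1) hξ.le
  have hcongr : ∫ ξ in Ioi (0 : ℝ), (1 - Real.exp (-x * ξ)) * φ ξ / ξ =
      ∫ ξ in Ioi (0 : ℝ), (G ξ).toReal := by
    refine setIntegral_congr_fun measurableSet_Ioi fun ξ hξ ↦ ?_
    rw [hGφ ξ hξ, ENNReal.toReal_ofReal (hφ0 ξ hξ)]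
  rw [hcongr, integral_toReal hGm.aemeasurable]
  · have := LambertW.lintegral_Ioi_exp hw
    rw [hW x hx] at this
    rw [this, ENNReal.toReal_ofReal hw.le]
  · filter_upwards [ae_restrict_mem measurableSet_Ioi] with ξ hξ
    rw [hGφ ξ hξ]
    exact ENNReal.ofReal_lt_top
end

section
/- Let W : ℝ → ℝ satisfy W(x) * exp(W(x)) = x and W(x) > 0 for all x > 0. Then for all x > 1/e, W(x) = 1 + (log x - 1) * exp(-(1/π) * ∫ from 0 to ∞ of arctan(π / (log x + t - log t)) / (1 + t) dt). -/
open Real MeasureTheory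

section

open Filter Topology Set

/-- The closed strip `|Im s| ≤ π`, on which `exp` parametrizes the plane cut along `(-∞, 0]`. -/
def closedStrip : Set ℂ := {s | |s.im| ≤ π}

/-- The quotient `(eˢ + s - (eʷ + w)) / (eˢ - eʷ)`, extended analytically to `s = w`. -/
noncomputable def lambertRatio (w : ℝ) (s : ℂ) : ℂ := 1 + (dslope Complex.exp w s)⁻¹

lemma dslope_exp_of_ne {c s : ℂ} (h : s ≠ c) :
    dslope Complex.exp c s = (Complex.exp s - Complex.exp c) / (s - c) := by
  rw [dslope_of_ne _ h, slope_def_field]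

lemma differentiable_dslope_exp (c : ℂ) : Differentiable ℂ (dslope Complex.exp c) := by
  rw [← differentiableOn_univ, Complex.differentiableOn_dslope univ_mem]
  exact Complex.differentiable_exp.differentiableOn

lemma closedStrip_mem_nhds_zero : closedStrip ∈ 𝓝 (0 : ℂ) := by
  have h : {s : ℂ | |s.im| < π} ∈ 𝓝 (0 : ℂ) :=
    (isOpen_lt (by fun_prop) continuous_const).mem_nhds (by simpa using pi_pos)
  exact mem_of_superset h fun s (hs : |s.im| < π) =>
    show |s.im| ≤ π from hs.le

lemma eq_zero_of_eq_neg_mul_sin {y : ℝ} (h : |y| ≤ π) {r : ℝ} (hr : 0 ≤ r)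
    (e : y = -(r * Real.sin y)) : y = 0 := by
  obtain ⟨h1, h2⟩ := abs_le.1 h
  rcases le_total 0 y with h0 | h0
  · have := mul_nonneg hr (Real.sin_nonneg_of_nonneg_of_le_pi h0 h2)
    linarith
  · have := mul_nonpos_of_nonneg_of_nonpos hr (Real.sin_nonpos_of_nonpos_of_neg_pi_le h0 h1)
    linarith

lemma exp_ne_exp_of_mem_closedStrip {w : ℝ} {s : ℂ} (hs : s ∈ closedStrip) (h : s ≠ w) :
    Complex.exp s ≠ Complex.exp w := by
  intro e
  obtain ⟨n, hn⟩ := Complex.exp_eq_exp_iff_exists_int.1 e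
  have him := congrArg Complex.im hn
  simp at him
  have hs' : |s.im| ≤ π := hs
  rw [him, abs_mul, abs_of_pos two_pi_pos] at hs'
  have hn1 : |(n : ℝ)| < 1 := by nlinarith [pi_pos]
  have hn0 : n = 0 := by
    rw [← Int.abs_lt_one_iff]
    exact_mod_cast hn1
  exact h (by simpa [hn0] using hn)

lemma dslope_exp_ne_zero {w : ℝ} {s : ℂ} (hs : s ∈ closedStrip) :
    dslope Complex.exp w s ≠ 0 := by
  by_cases h : s = w
  · subst h
    simp
  · rw [dslope_exp_of_ne h]
    exact div_ne_zero (sub_ne_zero.2 (exp_ne_exp_of_mem_closedStrip hs h)) (sub_ne_zero.2 h)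

lemma lambertRatio_of_ne {w : ℝ} {s : ℂ} (h : s ≠ w) :
    lambertRatio w s = 1 + (s - w) / (Complex.exp s - Complex.exp w) := by
  rw [lambertRatio, dslope_exp_of_ne h, inv_div]

lemma lambertRatio_mem_slitPlane {w : ℝ} {s : ℂ} (hs : s ∈ closedStrip) :
    lambertRatio w s ∈ Complex.slitPlane := by
  by_cases h : s = w
  · subst h
    have e : lambertRatio w w = ((1 + (Real.exp w)⁻¹ : ℝ) : ℂ) := by
      simp [lambertRatio]
    rw [e, Complex.ofReal_mem_slitPlane]
    positivity
  · by_contra hn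
    rw [Complex.mem_slitPlane_iff_not_le_zero, not_not] at hn
    obtain ⟨r, hr, hr'⟩ : ∃ r : ℝ, 0 ≤ r ∧ lambertRatio w s = -(r : ℂ) := by
      obtain ⟨h1, h2⟩ := Complex.le_def.1 hn
      refine ⟨-(lambertRatio w s).re, by simpa using h1, Complex.ext ?_ ?_⟩
      · simp
      · simpa using h2
    have hq := sub_ne_zero.2 (exp_ne_exp_of_mem_closedStrip hs h)
    rw [lambertRatio_of_ne h] at hr'
    have key : s - w = -((1 + r : ℝ) : ℂ) * (Complex.exp s - Complex.exp w) := by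
      field_simp at hr'
      push_cast
      linear_combination hr'
    have him := congrArg Complex.im key
    have hre := congrArg Complex.re key
    rw [← Complex.ofReal_neg, Complex.re_ofReal_mul] at hre
    rw [← Complex.ofReal_neg, Complex.im_ofReal_mul] at him
    simp only [Complex.sub_re, Complex.sub_im, Complex.ofReal_re, Complex.ofReal_im,
      Complex.exp_re, Complex.exp_im, Real.sin_zero, Real.cos_zero, mul_zero, mul_one,
      sub_zero] at him hre
    have hy : s.im = 0 :=
      eq_zero_of_eq_neg_mul_sin hs (r := (1 + r) * Real.exp s.re) (by positivity) (by linarith)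
    rw [hy, Real.cos_zero, mul_one] at hre
    have hx : s.re = w := by
      rcases lt_trichotomy s.re w with hlt | heq | hgt
      · have := Real.exp_lt_exp.2 hlt
        nlinarith
      · exact heq
      · have := Real.exp_lt_exp.2 hgt
        nlinarith
    exact h (Complex.ext (by simpa using hx) (by simpa using hy))

/-- The holomorphic function `(log Φ(s) - log Φ(0)) eˢ / (eˢ - 1)` on the strip, where `Φ` is
`lambertRatio w`. -/
noncomputable def lambertIntegrand (w : ℝ) (s : ℂ) : ℂ :=
  Complex.exp s * dslope (fun z => Complex.log (lambertRatio w z)) 0 s *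
    (dslope Complex.exp (0 : ℝ) s)⁻¹

lemma lambertIntegrand_of_ne {w : ℝ} {s : ℂ} (h : s ≠ 0) :
    lambertIntegrand w s = (Complex.log (lambertRatio w s) - Complex.log (lambertRatio w 0)) *
      (Complex.exp s / (Complex.exp s - 1)) := by
  rw [lambertIntegrand, dslope_exp_of_ne (by simpa using h), dslope_of_ne _ h, slope_def_field]
  have := sub_ne_zero.2 h
  simp only [Complex.ofReal_zero, sub_zero, Complex.exp_zero]
  field_simp

lemma differentiableOn_log_lambertRatio (w : ℝ) :
    DifferentiableOn ℂ (fun z => Complex.log (lambertRatio w z)) closedStrip := by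
  intro s hs
  refine DifferentiableAt.differentiableWithinAt ?_
  refine DifferentiableAt.clog ?_ (lambertRatio_mem_slitPlane hs)
  exact ((differentiable_dslope_exp w s).inv (dslope_exp_ne_zero hs)).const_add 1

lemma differentiableOn_lambertIntegrand (w : ℝ) :
    DifferentiableOn ℂ (lambertIntegrand w) closedStrip := by
  refine DifferentiableOn.mul (Complex.differentiable_exp.differentiableOn.mul ?_) ?_
  · rw [Complex.differentiableOn_dslope closedStrip_mem_nhds_zero]
    exact differentiableOn_log_lambertRatio w
  · exact (differentiable_dslope_exp _).differentiableOn.inv fun s hs => dslope_exp_ne_zero hs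

/-- Going to the end `l` of the real axis inside the closed strip. -/
noncomputable def stripEnd (l : Filter ℝ) : Filter ℂ := comap Complex.re l ⊓ 𝓟 closedStrip

lemma tendsto_re_stripEnd (l : Filter ℝ) : Tendsto Complex.re (stripEnd l) l :=
  tendsto_comap.mono_left inf_le_left

lemma eventually_mem_closedStrip (l : Filter ℝ) : ∀ᶠ s in stripEnd l, s ∈ closedStrip :=
  mem_inf_of_right (mem_principal_self _)

lemma tendsto_integral_of_tendsto_stripEnd {l : Filter ℝ} {f : ℂ → ℂ} {c : ℂ}
    (hf : Tendsto f (stripEnd l) (𝓝 c)) (hc : ContinuousOn f closedStrip) :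
    Tendsto (fun R : ℝ => ∫ y in -π..π, f (R + y * Complex.I)) l (𝓝 (2 * π * c)) := by
  rw [Metric.tendsto_nhds]
  intro ε hε
  have hδ : 0 < ε / (4 * π) := by positivity
  have h1 : ∀ᶠ s in stripEnd l, dist (f s) c < ε / (4 * π) := Metric.tendsto_nhds.1 hf _ hδ
  rw [stripEnd, eventually_inf_principal, eventually_comap] at h1
  filter_upwards [h1] with R hR
  have hmem : ∀ y ∈ Set.uIcc (-π) π, (R + y * Complex.I : ℂ) ∈ closedStrip := by
    intro y hy
    rw [uIcc_of_le (by linarith [pi_pos])] at hy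
    simpa [closedStrip, abs_le] using hy
  have hfi : IntervalIntegrable (fun y : ℝ => f (R + y * Complex.I)) volume (-π) π :=
    (hc.comp (by fun_prop) hmem).intervalIntegrable
  have e : (∫ y in -π..π, f (R + y * Complex.I)) - 2 * π * c =
      ∫ y in -π..π, (f (R + y * Complex.I) - c) := by
    rw [intervalIntegral.integral_sub hfi (by simp), intervalIntegral.integral_const,
      Complex.real_smul]
    push_cast
    ring
  rw [dist_eq_norm, e]
  have := intervalIntegral.norm_integral_le_of_norm_le_const (a := -π) (b := π)
    (f := fun y : ℝ => f (R + y * Complex.I) - c) (C := ε / (4 * π)) (by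
      intro y hy
      have := hR (R + y * Complex.I) (by simp) (hmem y (uIoc_subset_uIcc hy))
      rw [dist_eq_norm] at this
      exact this.le)
  refine this.trans_lt ?_
  rw [show π - -π = 2 * π by ring, abs_of_pos two_pi_pos]
  field_simp
  linarith

lemma norm_le_of_mem_closedStrip {s : ℂ} (hs : s ∈ closedStrip) : ‖s‖ ≤ |s.re| + π :=
  (Complex.norm_le_abs_re_add_abs_im s).trans (add_le_add_right hs _)

lemma tendsto_exp_neg_stripEnd_atTop :
    Tendsto (fun s => Complex.exp (-s)) (stripEnd atTop) (𝓝 0) := by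
  rw [tendsto_zero_iff_norm_tendsto_zero]
  simp only [Complex.norm_exp, Complex.neg_re]
  exact Real.tendsto_exp_neg_atTop_nhds_zero.comp (tendsto_re_stripEnd _)

lemma tendsto_exp_stripEnd_atBot : Tendsto Complex.exp (stripEnd atBot) (𝓝 0) := by
  rw [tendsto_zero_iff_norm_tendsto_zero]
  simp only [Complex.norm_exp]
  exact Real.tendsto_exp_atBot.comp (tendsto_re_stripEnd _)

lemma tendsto_abs_add_mul_exp_neg :
    Tendsto (fun u : ℝ => (|u| + π) * Real.exp (-u)) atTop (𝓝 0) := by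
  have h1 := Real.tendsto_pow_mul_exp_neg_atTop_nhds_zero 1
  have h2 := Real.tendsto_exp_neg_atTop_nhds_zero.const_mul π
  have := h1.add h2
  rw [mul_zero, add_zero] at this
  refine this.congr' ?_
  filter_upwards [eventually_ge_atTop 0] with u hu
  rw [abs_of_nonneg hu]
  ring

lemma tendsto_mul_exp_neg_stripEnd_atTop :
    Tendsto (fun s => s * Complex.exp (-s)) (stripEnd atTop) (𝓝 0) := by
  refine squeeze_zero_norm' ?_ (tendsto_abs_add_mul_exp_neg.comp (tendsto_re_stripEnd _))
  filter_upwards [eventually_mem_closedStrip atTop] with s hs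
  rw [norm_mul, Complex.norm_exp, Complex.neg_re]
  exact mul_le_mul_of_nonneg_right (norm_le_of_mem_closedStrip hs) (Real.exp_pos _).le

lemma tendsto_mul_exp_stripEnd_atBot :
    Tendsto (fun s => s * Complex.exp s) (stripEnd atBot) (𝓝 0) := by
  refine squeeze_zero_norm' ?_ ((tendsto_abs_add_mul_exp_neg.comp tendsto_neg_atBot_atTop).comp
    (tendsto_re_stripEnd _))
  filter_upwards [eventually_mem_closedStrip atBot] with s hs
  rw [norm_mul, Complex.norm_exp]
  simp only [Function.comp, abs_neg, neg_neg]
  exact mul_le_mul_of_nonneg_right (norm_le_of_mem_closedStrip hs) (Real.exp_pos _).le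

lemma tendsto_lambertRatio_stripEnd_atTop (w : ℝ) :
    Tendsto (lambertRatio w) (stripEnd atTop) (𝓝 1) := by
  have h : Tendsto (fun s : ℂ => 1 + (s * Complex.exp (-s) - w * Complex.exp (-s)) /
      (1 - Complex.exp w * Complex.exp (-s))) (stripEnd atTop)
      (𝓝 (1 + (0 - w * 0) / (1 - Complex.exp w * 0))) :=
    tendsto_const_nhds.add ((tendsto_mul_exp_neg_stripEnd_atTop.sub
      (tendsto_exp_neg_stripEnd_atTop.const_mul _)).div
      (tendsto_const_nhds.sub (tendsto_exp_neg_stripEnd_atTop.const_mul _)) (by simp))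
  simp only [mul_zero, sub_zero, zero_div, add_zero] at h
  refine h.congr' ?_
  filter_upwards [(tendsto_re_stripEnd atTop).eventually (eventually_gt_atTop w)] with s hs
  rw [lambertRatio_of_ne (by rintro rfl; simp at hs), ← sub_mul]
  rw [← mul_div_mul_right (s - w) _ (Complex.exp_ne_zero (-s)), sub_mul (Complex.exp s),
    ← Complex.exp_add s, add_neg_cancel, Complex.exp_zero]

lemma tendsto_lambertIntegrand_stripEnd_atTop (w : ℝ) :
    Tendsto (lambertIntegrand w) (stripEnd atTop) (𝓝 (-Complex.log (lambertRatio w 0))) := by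
  have h1 := (tendsto_lambertRatio_stripEnd_atTop w).clog Complex.one_mem_slitPlane
  have h2 : Tendsto (fun s => (1 - Complex.exp (-s))⁻¹) (stripEnd atTop) (𝓝 (1 - 0)⁻¹) :=
    (tendsto_const_nhds.sub tendsto_exp_neg_stripEnd_atTop).inv₀ (by simp)
  have h := (h1.sub_const (Complex.log (lambertRatio w 0))).mul h2
  simp only [Complex.log_one, zero_sub, sub_zero, inv_one, mul_one] at h
  refine h.congr' ?_
  filter_upwards [(tendsto_re_stripEnd atTop).eventually (eventually_gt_atTop 0)] with s hs
  rw [lambertIntegrand_of_ne (by rintro rfl; simp at hs)]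
  congr 1
  rw [Complex.exp_neg, ← one_div, ← mul_div_mul_left 1 _ (Complex.exp_ne_zero s), mul_one,
    mul_sub, mul_one, mul_inv_cancel₀ (Complex.exp_ne_zero s)]

lemma tendsto_exp_mul_lambertRatio_stripEnd_atBot (w : ℝ) :
    Tendsto (fun s => Complex.exp s * lambertRatio w s) (stripEnd atBot) (𝓝 0) := by
  have h : Tendsto (fun s : ℂ => Complex.exp s + (s * Complex.exp s - w * Complex.exp s) /
      (Complex.exp s - Complex.exp w)) (stripEnd atBot)
      (𝓝 (0 + (0 - w * 0) / (0 - Complex.exp w))) :=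
    tendsto_exp_stripEnd_atBot.add ((tendsto_mul_exp_stripEnd_atBot.sub
      (tendsto_exp_stripEnd_atBot.const_mul _)).div
      (tendsto_exp_stripEnd_atBot.sub_const _) (by simp))
  simp only [mul_zero, sub_zero, zero_div, add_zero] at h
  refine h.congr' ?_
  filter_upwards [(tendsto_re_stripEnd atBot).eventually (eventually_lt_atBot w)] with s hs
  rw [lambertRatio_of_ne (by rintro rfl; simp at hs)]
  ring

lemma eventually_one_le_norm_lambertRatio_stripEnd_atBot (w : ℝ) :
    ∀ᶠ s in stripEnd atBot, 1 ≤ ‖lambertRatio w s‖ := by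
  have hre := tendsto_re_stripEnd atBot
  filter_upwards [eventually_mem_closedStrip atBot, hre.eventually (eventually_lt_atBot w),
    hre.eventually (eventually_lt_atBot (w - 4 * Real.exp w))] with s hs hw hw'
  have hne : s ≠ w := by rintro rfl; simp at hw
  have hq : 0 < ‖Complex.exp s - Complex.exp w‖ :=
    norm_pos_iff.2 (sub_ne_zero.2 (exp_ne_exp_of_mem_closedStrip hs hne))
  have hq' : ‖Complex.exp s - Complex.exp w‖ ≤ 2 * Real.exp w := by
    refine (norm_sub_le _ _).trans ?_
    rw [Complex.norm_exp, Complex.norm_exp, Complex.ofReal_re]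
    linarith [Real.exp_lt_exp.2 hw]
  have hp : 4 * Real.exp w ≤ ‖s - w‖ := by
    refine le_trans ?_ (Complex.abs_re_le_norm _)
    rw [Complex.sub_re, Complex.ofReal_re]
    exact le_trans (by linarith) (neg_le_abs _)
  have hd : 2 ≤ ‖(s - w) / (Complex.exp s - Complex.exp w)‖ := by
    rw [norm_div, le_div_iff₀ hq]
    linarith
  rw [lambertRatio_of_ne hne]
  have := norm_sub_le (1 + (s - w) / (Complex.exp s - Complex.exp w)) 1
  rw [add_sub_cancel_left, norm_one] at this
  linarith

lemma norm_log_le_norm_add_pi {z : ℂ} (hz : 1 ≤ ‖z‖) : ‖Complex.log z‖ ≤ ‖z‖ + π := by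
  refine (Complex.norm_le_abs_re_add_abs_im _).trans (add_le_add ?_ ?_)
  · rw [Complex.log_re, abs_of_nonneg (Real.log_nonneg hz)]
    exact Real.log_le_self (norm_nonneg _)
  · rw [Complex.log_im]
    exact Complex.abs_arg_le_pi z

lemma tendsto_lambertIntegrand_stripEnd_atBot (w : ℝ) :
    Tendsto (lambertIntegrand w) (stripEnd atBot) (𝓝 0) := by
  have h1 : Tendsto (fun s => Complex.exp s * Complex.log (lambertRatio w s)) (stripEnd atBot)
      (𝓝 0) := by
    have hb := (tendsto_exp_mul_lambertRatio_stripEnd_atBot w).norm.add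
      (tendsto_exp_stripEnd_atBot.norm.mul_const π)
    rw [norm_zero, zero_mul, add_zero] at hb
    refine squeeze_zero_norm' ?_ hb
    filter_upwards [eventually_one_le_norm_lambertRatio_stripEnd_atBot w] with s hs
    rw [norm_mul, norm_mul, ← mul_add]
    exact mul_le_mul_of_nonneg_left (norm_log_le_norm_add_pi hs) (norm_nonneg _)
  have h := (h1.sub (tendsto_exp_stripEnd_atBot.mul_const (Complex.log (lambertRatio w 0)))).mul
    ((tendsto_exp_stripEnd_atBot.sub_const 1).inv₀ (by simp))
  simp only [zero_mul, sub_zero] at h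
  refine h.congr' ?_
  filter_upwards [(tendsto_re_stripEnd atBot).eventually (eventually_lt_atBot 0)] with s hs
  rw [lambertIntegrand_of_ne (by rintro rfl; simp at hs)]
  ring

lemma arg_eq_arctan_of_re_pos {z : ℂ} (hz : 0 < z.re) : z.arg = Real.arctan (z.im / z.re) := by
  obtain ⟨h1, h2⟩ := abs_lt.1 (Complex.abs_arg_lt_pi_div_two_iff.2 (Or.inl hz))
  rw [← Complex.tan_arg, Real.arctan_tan h1 h2]

lemma exp_add_add_sub_pos {w : ℝ} (hw : -1 < Real.exp w + w) (u : ℝ) :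
    0 < Real.exp w + w + Real.exp u - u := by
  linarith [Real.add_one_le_exp u]

lemma exp_add_pi_mul_I (u : ℝ) :
    Complex.exp (u + (π : ℝ) * Complex.I) = -(Real.exp u : ℂ) := by
  rw [Complex.exp_add, Complex.exp_pi_mul_I, Complex.ofReal_exp]
  ring

lemma exp_add_neg_pi_mul_I (u : ℝ) :
    Complex.exp (u + (-π : ℝ) * Complex.I) = -(Real.exp u : ℂ) := by
  rw [Complex.exp_add, Complex.ofReal_neg, neg_mul, Complex.exp_neg, Complex.exp_pi_mul_I,
    Complex.ofReal_exp]
  norm_num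

lemma lambertRatio_add_pi_mul_I (w u : ℝ) :
    lambertRatio w (u + (π : ℝ) * Complex.I) =
      (((Real.exp w + w + Real.exp u - u) / (Real.exp u + Real.exp w) : ℝ) : ℂ) +
        ((-π / (Real.exp u + Real.exp w) : ℝ) : ℂ) * Complex.I := by
  have hne : (u + (π : ℝ) * Complex.I : ℂ) ≠ w := fun h =>
    pi_ne_zero (by simpa using congrArg Complex.im h)
  have hpos : (Real.exp u + Real.exp w : ℂ) ≠ 0 := by
    exact_mod_cast (add_pos (Real.exp_pos u) (Real.exp_pos w)).ne'
  rw [lambertRatio_of_ne hne, exp_add_pi_mul_I, ← Complex.ofReal_exp,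
    show (-(Real.exp u : ℂ) - Real.exp w) = -(Real.exp u + Real.exp w) by ring, div_neg]
  push_cast at hpos ⊢
  field_simp
  ring

lemma lambertRatio_add_neg_pi_mul_I (w u : ℝ) :
    lambertRatio w (u + (-π : ℝ) * Complex.I) =
      (starRingEnd ℂ) (lambertRatio w (u + (π : ℝ) * Complex.I)) := by
  have hne : (u + (π : ℝ) * Complex.I : ℂ) ≠ w := fun h =>
    pi_ne_zero (by simpa using congrArg Complex.im h)
  have hne' : (u + (-π : ℝ) * Complex.I : ℂ) ≠ w := fun h =>
    pi_ne_zero (by simpa using congrArg Complex.im h)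
  rw [lambertRatio_of_ne hne, lambertRatio_of_ne hne', exp_add_pi_mul_I, exp_add_neg_pi_mul_I]
  simp [← Complex.exp_conj]

lemma log_lambertRatio_jump {w : ℝ} (hw : -1 < Real.exp w + w) (u : ℝ) :
    Complex.log (lambertRatio w (u + (-π : ℝ) * Complex.I)) -
      Complex.log (lambertRatio w (u + (π : ℝ) * Complex.I)) =
      2 * Complex.I * (Real.arctan (π / (Real.exp w + w + Real.exp u - u)) : ℝ) := by
  have hA := exp_add_add_sub_pos hw u
  have hS := add_pos (Real.exp_pos u) (Real.exp_pos w)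
  have hre : (lambertRatio w (u + (π : ℝ) * Complex.I)).re =
      (Real.exp w + w + Real.exp u - u) / (Real.exp u + Real.exp w) := by
    rw [lambertRatio_add_pi_mul_I, Complex.add_re, Complex.re_ofReal_mul, Complex.ofReal_re,
      Complex.I_re, mul_zero, add_zero]
  have him : (lambertRatio w (u + (π : ℝ) * Complex.I)).im =
      -π / (Real.exp u + Real.exp w) := by
    rw [lambertRatio_add_pi_mul_I, Complex.add_im, Complex.im_ofReal_mul, Complex.ofReal_im,
      Complex.I_im, mul_one, zero_add]
  have hslit : lambertRatio w (u + (π : ℝ) * Complex.I) ∈ Complex.slitPlane :=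
    Or.inl (by rw [hre]; positivity)
  rw [lambertRatio_add_neg_pi_mul_I, Complex.log_conj _ (Complex.mem_slitPlane_iff_arg.1 hslit).1,
    ← neg_sub, Complex.sub_conj, Complex.log_im, arg_eq_arctan_of_re_pos (by rw [hre]; positivity),
    hre, him, div_div_div_cancel_right₀ hS.ne', neg_div, Real.arctan_neg]
  push_cast
  ring

/-- The integrand obtained from the substitution `t = eᵘ`. -/
noncomputable def burnistonSiewertIntegrand (a u : ℝ) : ℝ :=
  Real.arctan (π / (a + Real.exp u - u)) * (Real.exp u / (1 + Real.exp u))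

lemma burnistonSiewertIntegrand_nonneg {w : ℝ} (hw : -1 < Real.exp w + w) (u : ℝ) :
    0 ≤ burnistonSiewertIntegrand (Real.exp w + w) u := by
  have hA := exp_add_add_sub_pos hw u
  refine mul_nonneg (Real.arctan_nonneg.2 ?_) ?_ <;> positivity

lemma continuous_burnistonSiewertIntegrand {w : ℝ} (hw : -1 < Real.exp w + w) :
    Continuous (burnistonSiewertIntegrand (Real.exp w + w)) := by
  refine Continuous.mul (Real.continuous_arctan.comp ?_) ?_
  · exact continuous_const.div (by fun_prop) fun u => (exp_add_add_sub_pos hw u).ne'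
  · exact Real.continuous_exp.div (by fun_prop) fun u => by positivity

lemma lambertIntegrand_jump {w : ℝ} (hw : -1 < Real.exp w + w) (u : ℝ) :
    lambertIntegrand w (u + (-π : ℝ) * Complex.I) - lambertIntegrand w (u + (π : ℝ) * Complex.I) =
      2 * Complex.I * (burnistonSiewertIntegrand (Real.exp w + w) u : ℝ) := by
  have hne : (u + (π : ℝ) * Complex.I : ℂ) ≠ 0 := fun h =>
    pi_ne_zero (by simpa using congrArg Complex.im h)
  have hne' : (u + (-π : ℝ) * Complex.I : ℂ) ≠ 0 := fun h =>
    pi_ne_zero (by simpa using congrArg Complex.im h)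
  rw [lambertIntegrand_of_ne hne, lambertIntegrand_of_ne hne', exp_add_pi_mul_I,
    exp_add_neg_pi_mul_I, ← sub_mul, sub_sub_sub_cancel_right, log_lambertRatio_jump hw,
    burnistonSiewertIntegrand, Complex.ofReal_mul, ← mul_assoc]
  congr 1
  rw [show (-(Real.exp u : ℂ) - 1) = -(1 + Real.exp u) by ring, neg_div_neg_eq]
  push_cast
  rfl

lemma integral_rect_lambertIntegrand {w : ℝ} (hw : -1 < Real.exp w + w) (R : ℝ) :
    2 * Complex.I * ((∫ u in -R..R, burnistonSiewertIntegrand (Real.exp w + w) u : ℝ) : ℂ) +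
      Complex.I * (∫ y in -π..π, lambertIntegrand w ((R : ℝ) + y * Complex.I)) -
      Complex.I * (∫ y in -π..π, lambertIntegrand w ((-R : ℝ) + y * Complex.I)) = 0 := by
  have hd := differentiableOn_lambertIntegrand w
  have h := Complex.integral_boundary_rect_eq_zero_of_differentiableOn (lambertIntegrand w)
    ⟨-R, -π⟩ ⟨R, π⟩ (hd.mono fun s hs => by
      have := hs.2
      rw [mem_preimage, uIcc_of_le (by linarith [pi_pos])] at this
      exact abs_le.2 this)
  have hfi : ∀ y : ℝ, |y| ≤ π →
      IntervalIntegrable (fun x : ℝ => lambertIntegrand w (x + y * Complex.I)) volume (-R) R :=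
    fun y hy => (hd.continuousOn.comp_continuous (by fun_prop)
      fun x => by simpa [closedStrip] using hy).intervalIntegrable _ _
  simp only [smul_eq_mul] at h
  rw [← intervalIntegral.integral_sub (hfi _ (by rw [abs_neg, abs_of_pos pi_pos]))
    (hfi _ (by rw [abs_of_pos pi_pos]))] at h
  simp only [lambertIntegrand_jump hw] at h
  rwa [intervalIntegral.integral_const_mul, intervalIntegral.integral_ofReal] at h

lemma tendsto_intervalIntegral_burnistonSiewertIntegrand {w : ℝ} (hw : -1 < Real.exp w + w) :
    Tendsto (fun R : ℝ =>
      ((∫ u in -R..R, burnistonSiewertIntegrand (Real.exp w + w) u : ℝ) : ℂ)) atTop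
      (𝓝 (π * Complex.log (lambertRatio w 0))) := by
  have hc := (differentiableOn_lambertIntegrand w).continuousOn
  have h1 := tendsto_integral_of_tendsto_stripEnd (tendsto_lambertIntegrand_stripEnd_atTop w) hc
  have h2 := (tendsto_integral_of_tendsto_stripEnd
    (tendsto_lambertIntegrand_stripEnd_atBot w) hc).comp tendsto_neg_atTop_atBot
  have h := (h2.sub h1).div_const 2
  rw [show (2 * π * 0 - 2 * π * -Complex.log (lambertRatio w 0)) / 2 =
    π * Complex.log (lambertRatio w 0) by ring] at h
  refine h.congr fun R => ?_
  have hR := integral_rect_lambertIntegrand hw R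
  have hI : Complex.I * Complex.I = -1 := Complex.I_mul_I
  simp only [Function.comp]
  linear_combination (Complex.I / 2) * hR +
    (-(((∫ u in -R..R, burnistonSiewertIntegrand (Real.exp w + w) u : ℝ) : ℂ)) -
      (∫ y in -π..π, lambertIntegrand w ((R : ℝ) + y * Complex.I)) / 2 +
      (∫ y in -π..π, lambertIntegrand w ((-R : ℝ) + y * Complex.I)) / 2) * hI

lemma integral_burnistonSiewertIntegrand {w : ℝ} (hw : -1 < Real.exp w + w) :
    ((∫ u, burnistonSiewertIntegrand (Real.exp w + w) u : ℝ) : ℂ) =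
      π * Complex.log (lambertRatio w 0) := by
  have h := tendsto_intervalIntegral_burnistonSiewertIntegrand hw
  have hfi : Integrable (burnistonSiewertIntegrand (Real.exp w + w)) := by
    refine integrable_of_intervalIntegral_norm_tendsto
      (π * Complex.log (lambertRatio w 0)).re (l := atTop) (a := fun R : ℝ => -R) (b := id)
      (fun R => (continuous_burnistonSiewertIntegrand hw).integrableOn_Ioc)
      tendsto_neg_atTop_atBot tendsto_id ?_
    simp only [Real.norm_of_nonneg (burnistonSiewertIntegrand_nonneg hw _)]
    exact (Complex.continuous_re.tendsto _).comp h
  exact tendsto_nhds_unique ((Complex.continuous_ofReal.tendsto _).comp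
    (intervalIntegral_tendsto_integral hfi tendsto_neg_atTop_atBot tendsto_id)) h

lemma setIntegral_Ioi_eq_integral_burnistonSiewertIntegrand (a : ℝ) :
    ∫ t in Set.Ioi (0 : ℝ), Real.arctan (π / (a + t - Real.log t)) / (1 + t) =
      ∫ u, burnistonSiewertIntegrand a u := by
  rw [← Real.range_exp, ← image_univ, integral_image_eq_integral_abs_deriv_smul MeasurableSet.univ
    (fun x _ => (Real.hasDerivAt_exp x).hasDerivWithinAt) Real.exp_injective.injOn,
    setIntegral_univ]
  refine integral_congr_ae (ae_of_all _ fun u => ?_)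
  simp only [burnistonSiewertIntegrand, Real.log_exp, abs_of_pos (Real.exp_pos u), smul_eq_mul]
  ring

lemma lambertRatio_zero_eq_exp {w : ℝ} (hw : -1 < Real.exp w + w) :
    lambertRatio w 0 =
      (Real.exp (1 / π * ∫ u, burnistonSiewertIntegrand (Real.exp w + w) u) : ℝ) := by
  have hπ : (π : ℂ) ≠ 0 := by exact_mod_cast pi_ne_zero
  have hΦ : lambertRatio w 0 ∈ Complex.slitPlane :=
    lambertRatio_mem_slitPlane (mem_of_mem_nhds closedStrip_mem_nhds_zero)
  rw [Complex.ofReal_exp, Complex.ofReal_mul, integral_burnistonSiewertIntegrand hw,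
    Complex.ofReal_div, Complex.ofReal_one, ← mul_assoc, one_div, inv_mul_cancel₀ hπ, one_mul,
    Complex.exp_log (Complex.slitPlane_ne_zero hΦ)]

lemma exp_eq_one_add_mul_exp_neg_integral {w : ℝ} (hw : -1 < Real.exp w + w) :
    Real.exp w = 1 + (Real.exp w + w - 1) *
      Real.exp (-(1 / π) * ∫ u, burnistonSiewertIntegrand (Real.exp w + w) u) := by
  by_cases h0 : w = 0
  · simp [h0]
  have hq : 1 - Real.exp w ≠ 0 := fun h => h0 (Real.exp_eq_one_iff _ |>.1 (sub_eq_zero.1 h).symm)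
  have h := lambertRatio_zero_eq_exp hw
  rw [lambertRatio_of_ne (by exact_mod_cast Ne.symm h0), Complex.exp_zero] at h
  have h' : 1 + (0 - w) / (1 - Real.exp w) =
      Real.exp (1 / π * ∫ u, burnistonSiewertIntegrand (Real.exp w + w) u) := by
    exact_mod_cast h
  rw [neg_mul, Real.exp_neg, ← h', one_add_div hq, inv_div]
  have hne : 1 - Real.exp w + (0 - w) ≠ 0 := fun hz => by
    rw [one_add_div hq, hz, zero_div] at h'
    exact (Real.exp_pos _).ne h'
  field_simp
  ring

end

/-- Burniston–Siewert representation of Lambert W for `x > 1/e`. -/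
theorem lambertW_burniston_siewert (W : ℝ → ℝ)
    (hW : ∀ x > 0, W x * Real.exp (W x) = x) (hWpos : ∀ x > 0, W x > 0) :
    ∀ x > 1 / Real.exp 1,
      W x = 1 + (Real.log x - 1) *
        Real.exp (-(1 / π) * ∫ t in Set.Ioi (0:ℝ),
          Real.arctan (π / (Real.log x + t - Real.log t)) / (1 + t)) := by
  intro x hx
  have hx0 : 0 < x := lt_trans (by positivity) hx
  have hpos := hWpos x hx0
  have hexp : Real.exp (Real.log (W x)) = W x := Real.exp_log hpos
  have hlog : Real.log x = Real.exp (Real.log (W x)) + Real.log (W x) := by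
    conv_lhs => rw [← hW x hx0]
    rw [Real.log_mul hpos.ne' (Real.exp_pos _).ne', Real.log_exp, hexp, add_comm]
  have hw : -1 < Real.exp (Real.log (W x)) + Real.log (W x) := by
    rw [← hlog, Real.lt_log_iff_exp_lt hx0, Real.exp_neg, ← one_div]
    exact hx
  rw [setIntegral_Ioi_eq_integral_burnistonSiewertIntegrand, hlog]
  conv_lhs => rw [← hexp]
  exact exp_eq_one_add_mul_exp_neg_integral hw
end
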